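/- Let Φ_E be a regular Gauss IFS with conformal dimension δ = δ_E and conformal measure μ, satisfying Assumptions 1, C (with constant λ > 1), and 3. Let ψ be a doubling dimension function with Ψ(r) = r^{-δ}ψ(r), and define J_{k,α,ε} and S_{α,ε} as below. Then, with implied constants independent of ω: for all ω ∈ E^ℕ, sup{α > 0 : ω ∈ S_{α,1}} ≍ D̄^ψ_μ(π(ω)) (assuming Ψ is decreasing), and inf{α > 0 : ω ∈ S_{α,-1}} ≍ D̲^ψ_μ(π(ω)) (assuming Ψ is increasing). -/

import Mathlib

open MeasureTheory Metric Filter Set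
open scoped ENNReal Topology NNReal

noncomputable section

/-- The Gauss map `φ_a(x) = 1/(a+x)`. -/
def gaussMap (a : ℕ) (x : ℝ) : ℝ := 1 / (a + x)

/-- `φ_ω = φ_{ω₁} ∘ ⋯ ∘ φ_{ω_n}` for a finite word `ω`. -/
def wordMap : List ℕ → ℝ → ℝ
  | [] => fun x => x
  | a :: ω => fun x => gaussMap a (wordMap ω x)

/-- `‖φ_ω'‖ = sup_{x ∈ [0,1]} |φ_ω'(x)|`. -/
def derivNorm (ω : List ℕ) : ℝ := ⨆ x : Icc (0 : ℝ) 1, |deriv (wordMap ω) (x : ℝ)|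

/-- The cylinder `[ω] = φ_ω([0,1])`. -/
def cyl (ω : List ℕ) : Set ℝ := wordMap ω '' Icc 0 1

/-- The set of finite words over the alphabet `E`. -/
def words (E : Set ℕ) : Set (List ℕ) := {ω | ∀ a ∈ ω, a ∈ E}

/-- The coding map `π(ω) = [0; ω₀, ω₁, …]`. -/
def codingMap (ω : ℕ → ℕ) : ℝ :=
  limUnder atTop fun n => wordMap (List.ofFn fun i : Fin n => ω i) 0

/-- The limit set `Λ_E`. -/
def limitSet (E : Set ℕ) : Set ℝ := codingMap '' {ω | ∀ n, ω n ∈ E}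

/-- The pressure function of the Gauss IFS on the alphabet `E`. -/
def pressure (E : Set ℕ) (s : ℝ) : ℝ :=
  limUnder atTop fun n : ℕ =>
    (n : ℝ)⁻¹ * Real.log (∑' ω : Fin n → E, derivNorm (List.ofFn fun i => (ω i : ℕ)) ^ s)

/-- `μ` is the `δ`-conformal measure of the Gauss IFS on the alphabet `E`. -/
def IsConformal (E : Set ℕ) (δ : ℝ) (μ : Measure ℝ) : Prop :=
  IsProbabilityMeasure μ ∧ μ (limitSet E)ᶜ = 0 ∧
    ∀ A : Set ℝ, A ⊆ Icc 0 1 → MeasurableSet A →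
      μ A = ∑' a : E, ENNReal.ofReal (∫ x in gaussMap (a : ℕ) ⁻¹' A, |deriv (gaussMap (a : ℕ)) x| ^ δ ∂μ)

/-- The set of prime numbers. -/
def primes : Set ℕ := {p | p.Prime}

/-- `μ(J) = ∑_{a ∈ J} μ([a])` for a set of letters `J`. -/
def cylMass (μ : Measure ℝ) (J : Set ℕ) : ℝ≥0∞ := ∑' a : J, μ (cyl [(a : ℕ)])

/-- A dimension function: continuous, increasing, positive, with `ψ(0⁺) = 0`. -/
def IsDimFun (ψ : ℝ → ℝ) : Prop :=
  ContinuousOn ψ (Ioi 0) ∧ MonotoneOn ψ (Ioi 0) ∧ (∀ r : ℝ, 0 < r → 0 < ψ r) ∧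
    Tendsto ψ (𝓝[>] (0 : ℝ)) (𝓝 0)

/-- A doubling function. -/
def IsDoubling (ψ : ℝ → ℝ) : Prop :=
  ∀ C₁ : ℝ, 1 ≤ C₁ → ∃ C₂ : ℝ, 1 ≤ C₂ ∧ ∀ x y : ℝ, 0 < x → 0 < y →
    C₁⁻¹ ≤ x / y → x / y ≤ C₁ → C₂⁻¹ ≤ ψ x / ψ y ∧ ψ x / ψ y ≤ C₂

open Classical in
/-- The `ψ`-dimensional Hausdorff measure `H^ψ`. -/
def hausdorffPsi (ψ : ℝ → ℝ) : Measure ℝ :=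
  Measure.mkMetric fun d => if d = 0 then 0 else ENNReal.ofReal (ψ d.toReal)

/-- `H^ψ(μ) = inf {H^ψ(A) : A Borel, μ(ℝ∖A) = 0}`. -/
def hausdorffPsiOf (ψ : ℝ → ℝ) (μ : Measure ℝ) : ℝ≥0∞ :=
  ⨅ (A : Set ℝ) (_ : MeasurableSet A) (_ : μ Aᶜ = 0), hausdorffPsi ψ A

/-- The `ψ`-dimensional packing pre-measure `P̃^ψ`. -/
def packingPre (ψ : ℝ → ℝ) (A : Set ℝ) : ℝ≥0∞ :=
  ⨅ (ε : ℝ) (_ : 0 < ε),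
    ⨆ (D : Set (ℝ × ℝ)) (_ : D.Countable)
      (_ : ∀ p ∈ D, p.1 ∈ A ∧ 0 < p.2 ∧ 2 * p.2 ≤ ε)
      (_ : D.PairwiseDisjoint fun p => closedBall p.1 p.2),
      ∑' p : D, ENNReal.ofReal (ψ (2 * (p : ℝ × ℝ).2))

/-- The `ψ`-dimensional packing measure `P^ψ`. -/
def packingPsi (ψ : ℝ → ℝ) (A : Set ℝ) : ℝ≥0∞ :=
  ⨅ (S : ℕ → Set ℝ) (_ : A ⊆ ⋃ i, S i), ∑' i, packingPre ψ (S i)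

/-- `P^ψ(μ) = inf {P^ψ(A) : A Borel, μ(ℝ∖A) = 0}`. -/
def packingPsiOf (ψ : ℝ → ℝ) (μ : Measure ℝ) : ℝ≥0∞ :=
  ⨅ (A : Set ℝ) (_ : MeasurableSet A) (_ : μ Aᶜ = 0), packingPsi ψ A

/-- Assumption C with constant `λ`: `μ({a : λ⁻¹r < ‖φ_a'‖ ≤ r}) ≍ μ({a : ‖φ_a'‖ ≤ r})`. -/
def AssumptionC (E : Set ℕ) (μ : Measure ℝ) (lam : ℝ) : Prop :=
  ∃ c C : ℝ≥0∞, 0 < c ∧ C ≠ ⊤ ∧ ∀ r : ℝ, 0 < r → r ≤ 1 →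
    c * cylMass μ {a ∈ E | derivNorm [a] ≤ r} ≤
        cylMass μ {a ∈ E | lam⁻¹ * r < derivNorm [a] ∧ derivNorm [a] ≤ r} ∧
      cylMass μ {a ∈ E | lam⁻¹ * r < derivNorm [a] ∧ derivNorm [a] ≤ r} ≤
        C * cylMass μ {a ∈ E | derivNorm [a] ≤ r}

/-- `f` is regularly varying with exponent `s`. -/
def RegVarying (f : ℝ → ℝ) (s : ℝ) : Prop :=
  ∀ a : ℝ, 1 < a → Tendsto (fun x => f (a * x) / f x) atTop (𝓝 (a ^ s))

/-- Assumption 1: `#(E ∩ [N,2N]) ≍ f(N)`. -/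
def Assumption1 (E : Set ℕ) (f : ℝ → ℝ) : Prop :=
  ∃ c C : ℝ, 0 < c ∧ 0 < C ∧ ∀ N : ℕ, 1 ≤ N →
    c * f N ≤ ((E ∩ Icc N (2 * N)).ncard : ℝ) ∧ ((E ∩ Icc N (2 * N)).ncard : ℝ) ≤ C * f N

/-- Assumption 3: the Lyapunov exponent `-∑_{a∈E} μ(a) log ‖φ_a'‖` is finite. -/
def Assumption3 (E : Set ℕ) (μ : Measure ℝ) : Prop :=
  Summable fun a : E => (μ (cyl [(a : ℕ)])).toReal * Real.log (derivNorm [(a : ℕ)])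

/-- `W_k = {ω : λ^{-(k+1)} < ‖φ_ω'‖ ≤ λ^{-k}}`. -/
def W (lam : ℝ) (k : ℕ) : Set (List ℕ) :=
  {ω | lam ^ (-(k : ℝ) - 1) < derivNorm ω ∧ derivNorm ω ≤ lam ^ (-(k : ℝ))}

/-- `A_k = ⋃ {[ωa] : ω ∈ W_k ∩ E^*, a ∈ J}`. -/
def cylUnion (E : Set ℕ) (lam : ℝ) (k : ℕ) (J : Set ℕ) : Set ℝ :=
  ⋃ ω ∈ W lam k ∩ words E, ⋃ a ∈ J, cyl (ω ++ [a])

/-- `S_J`: sequences in `E^ℕ` with infinitely many `(n,k)` such that `ω|n ∈ W_k`, `ω_{n+1} ∈ J_k`. -/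
def Sset (E : Set ℕ) (lam : ℝ) (J : ℕ → Set ℕ) : Set (ℕ → ℕ) :=
  {ω | (∀ n, ω n ∈ E) ∧
    {p : ℕ × ℕ | (List.ofFn fun i : Fin p.1 => ω i) ∈ W lam p.2 ∧ ω p.1 ∈ J p.2}.Infinite}

/-- The upper density `D̄^ψ_μ(x)`. -/
def upperDensity (ψ : ℝ → ℝ) (μ : Measure ℝ) (x : ℝ) : ℝ≥0∞ :=
  limsup (fun r => μ (closedBall x r) / ENNReal.ofReal (ψ r)) (𝓝[>] (0 : ℝ))

/-- The lower density `D̲^ψ_μ(x)`. -/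
def lowerDensity (ψ : ℝ → ℝ) (μ : Measure ℝ) (x : ℝ) : ℝ≥0∞ :=
  liminf (fun r => μ (closedBall x r) / ENNReal.ofReal (ψ r)) (𝓝[>] (0 : ℝ))

/-- `J_{k,α,1} = {a ∈ E : ∃ r ∈ [‖φ_a'‖,1], r^{-δ} μ(B([a],r)) ≥ α Ψ(λ^{-k} r)}`. -/
def JsetH (E : Set ℕ) (δ : ℝ) (μ : Measure ℝ) (Ψ : ℝ → ℝ) (lam : ℝ) (k : ℕ) (α : ℝ) : Set ℕ :=
  {a ∈ E | ∃ r : ℝ, derivNorm [a] ≤ r ∧ r ≤ 1 ∧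
    ENNReal.ofReal (α * r ^ δ * Ψ (lam ^ (-(k : ℝ)) * r)) ≤ μ (cthickening r (cyl [a]))}

/-- `J_{k,α,-1} = {a ∈ E : ∃ r ∈ [‖φ_a'‖,1], r^{-δ} μ(B([a],r)) ≤ α Ψ(λ^{-k} r)}`. -/
def JsetP (E : Set ℕ) (δ : ℝ) (μ : Measure ℝ) (Ψ : ℝ → ℝ) (lam : ℝ) (k : ℕ) (α : ℝ) : Set ℕ :=
  {a ∈ E | ∃ r : ℝ, derivNorm [a] ≤ r ∧ r ≤ 1 ∧
    μ (cthickening r (cyl [a])) ≤ ENNReal.ofReal (α * r ^ δ * Ψ (lam ^ (-(k : ℝ)) * r))}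

/-- `S_{α,1}`. -/
def SsetH (E : Set ℕ) (δ : ℝ) (μ : Measure ℝ) (Ψ : ℝ → ℝ) (lam : ℝ) (α : ℝ) : Set (ℕ → ℕ) :=
  {ω | {p : ℕ × ℕ | (List.ofFn fun i : Fin p.1 => ω i) ∈ W lam p.2 ∧
    ω p.1 ∈ JsetH E δ μ Ψ lam p.2 α}.Infinite}

/-- `S_{α,-1}`. -/
def SsetP (E : Set ℕ) (δ : ℝ) (μ : Measure ℝ) (Ψ : ℝ → ℝ) (lam : ℝ) (α : ℝ) : Set (ℕ → ℕ) :=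
  {ω | {p : ℕ × ℕ | (List.ofFn fun i : Fin p.1 => ω i) ∈ W lam p.2 ∧
    ω p.1 ∈ JsetP E δ μ Ψ lam p.2 α}.Infinite}

/-- `M(x,pre,r) = ∑_{a ∈ E, [pre·a] ⊆ B(x,r)} μ([pre·a])`. -/
def Mform (E : Set ℕ) (μ : Measure ℝ) (x : ℝ) (pre : List ℕ) (r : ℝ) : ℝ≥0∞ :=
  ∑' a : {a : ℕ // a ∈ E ∧ cyl (pre ++ [a]) ⊆ closedBall x r}, μ (cyl (pre ++ [(a : ℕ)]))

mutual
/-- Numerator of the Möbius map `wordMap ω`. -/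
def wordNum : List ℕ → ℝ → ℝ
  | [], x => x
  | _ :: ω, x => wordDen ω x

/-- Denominator of the Möbius map `wordMap ω`. -/
def wordDen : List ℕ → ℝ → ℝ
  | [], _ => 1
  | a :: ω, x => a * wordDen ω x + wordNum ω x
end

theorem wordDen_pos {ω : List ℕ} (hω : ∀ a ∈ ω, 1 ≤ a) {x : ℝ} (hx : -1 < x) :
    0 < wordDen ω x ∧ 0 < wordDen ω x + wordNum ω x := by
  induction ω with
  | nil => simp only [wordDen, wordNum]; constructor <;> linarith
  | cons a ω ih =>
    obtain ⟨h1, h2⟩ := ih fun b hb => hω b (List.mem_cons_of_mem _ hb)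
    have ha : (1 : ℝ) ≤ a := by exact_mod_cast hω a List.mem_cons_self
    have h3 : 0 < a * wordDen ω x + wordNum ω x := by nlinarith
    simp only [wordDen, wordNum]
    constructor <;> linarith

theorem wordMap_eq_div {ω : List ℕ} (hω : ∀ a ∈ ω, 1 ≤ a) {x : ℝ} (hx : -1 < x) :
    wordMap ω x = wordNum ω x / wordDen ω x := by
  induction ω with
  | nil => simp [wordMap, wordDen, wordNum]
  | cons a ω ih =>
    have hω' : ∀ b ∈ ω, 1 ≤ b := fun b hb => hω b (List.mem_cons_of_mem _ hb)
    have h1 := (wordDen_pos hω' hx).1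
    have h2 := (wordDen_pos hω hx).1
    simp only [wordMap, wordDen, wordNum, gaussMap, ih hω'] at h2 ⊢
    have : (a : ℝ) + wordNum ω x / wordDen ω x
        = (a * wordDen ω x + wordNum ω x) / wordDen ω x := by
      field_simp
    rw [this, one_div_div]

theorem wordDen_cons {a : ℕ} {ω : List ℕ} (hω : ∀ a ∈ ω, 1 ≤ a) {x : ℝ} (hx : -1 < x) :
    wordDen (a :: ω) x = wordDen ω x * (a + wordMap ω x) := by
  have h1 := (wordDen_pos hω hx).1
  rw [wordMap_eq_div hω hx, wordDen]
  field_simp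

theorem wordDen_append {ω τ : List ℕ} (hω : ∀ a ∈ ω, 1 ≤ a) (hτ : ∀ a ∈ τ, 1 ≤ a) {x : ℝ}
    (hx : -1 < x) :
    wordDen (ω ++ τ) x = wordDen τ x * wordDen ω (wordMap τ x) ∧
      wordNum (ω ++ τ) x = wordDen τ x * wordNum ω (wordMap τ x) := by
  have h1 := (wordDen_pos hτ hx).1
  induction ω with
  | nil =>
    simp only [List.nil_append, wordDen, wordNum, wordMap_eq_div hτ hx]
    constructor <;> field_simp
  | cons a ω ih =>
    obtain ⟨h2, h3⟩ := ih fun b hb => hω b (List.mem_cons_of_mem _ hb)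
    simp only [List.cons_append, wordDen, wordNum, h2, h3]
    exact ⟨by ring, trivial⟩

theorem wordMap_append (ω τ : List ℕ) (x : ℝ) :
    wordMap (ω ++ τ) x = wordMap ω (wordMap τ x) := by
  induction ω with
  | nil => rfl
  | cons a ω ih => simp [wordMap, ih]

theorem wordDen_affine (ω : List ℕ) (x : ℝ) :
    wordDen ω x = wordDen ω 0 + x * (wordDen ω 1 - wordDen ω 0) ∧
      wordNum ω x = wordNum ω 0 + x * (wordNum ω 1 - wordNum ω 0) := by
  induction ω with
  | nil => simp [wordDen, wordNum]
  | cons a ω ih =>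
    obtain ⟨h1, h2⟩ := ih
    simp only [wordDen, wordNum]
    refine ⟨?_, h1⟩
    rw [h1, h2]; ring

theorem wordDen_zero_le_one {ω : List ℕ} (hω : ∀ a ∈ ω, 1 ≤ a) :
    (wordDen ω 0 ≤ wordDen ω 1 ∧ wordNum ω 0 ≤ wordNum ω 1) ∧
      wordDen ω 1 ≤ 2 * wordDen ω 0 ∧
      wordDen ω 1 + wordNum ω 1 ≤ 2 * (wordDen ω 0 + wordNum ω 0) := by
  induction ω with
  | nil => simp [wordDen, wordNum]; norm_num
  | cons a ω ih =>
    obtain ⟨⟨h1, h2⟩, h3, h4⟩ := ih fun b hb => hω b (List.mem_cons_of_mem _ hb)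
    have ha : (1 : ℝ) ≤ a := by exact_mod_cast hω a List.mem_cons_self
    simp only [wordDen, wordNum]
    refine ⟨⟨?_, h1⟩, ?_, ?_⟩ <;> nlinarith

theorem wordDen_mem_Icc {ω : List ℕ} (hω : ∀ a ∈ ω, 1 ≤ a) {x : ℝ} (hx : x ∈ Icc (0 : ℝ) 1) :
    wordDen ω x ∈ Icc (wordDen ω 0) (2 * wordDen ω 0) := by
  obtain ⟨⟨h1, -⟩, h2, -⟩ := wordDen_zero_le_one hω
  rw [(wordDen_affine ω x).1]
  constructor <;> nlinarith [hx.1, hx.2]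

theorem wordDen_mem_Icc_of_neg {ω : List ℕ} (hω : ∀ a ∈ ω, 1 ≤ a) {x : ℝ}
    (hx : x ∈ Icc (-1 / 2 : ℝ) 0) : wordDen ω x ≤ wordDen ω 0 := by
  obtain ⟨⟨h1, -⟩, h2, -⟩ := wordDen_zero_le_one hω
  rw [(wordDen_affine ω x).1]
  nlinarith [hx.1, hx.2]

theorem wordDen_le_two_mul {ω : List ℕ} (hω : ∀ a ∈ ω, 1 ≤ a) {x : ℝ}
    (hx : x ∈ Icc (-1 / 2 : ℝ) 1) : wordDen ω x ≤ 2 * wordDen ω 0 := by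
  have h := (wordDen_pos hω (by norm_num : (-1 : ℝ) < 0)).1
  rcases le_total x 0 with h0 | h0
  · linarith [wordDen_mem_Icc_of_neg hω ⟨hx.1, h0⟩]
  · exact (wordDen_mem_Icc hω ⟨h0, hx.2⟩).2

theorem wordNum_mul_wordDen_sub (ω : List ℕ) (x y : ℝ) :
    wordNum ω x * wordDen ω y - wordNum ω y * wordDen ω x = (-1) ^ ω.length * (x - y) := by
  induction ω with
  | nil => simp [wordDen, wordNum]
  | cons a ω ih =>
    simp only [wordDen, wordNum, List.length_cons, pow_succ]
    linear_combination -ih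

theorem wordMap_sub {ω : List ℕ} (hω : ∀ a ∈ ω, 1 ≤ a) {x y : ℝ} (hx : -1 < x) (hy : -1 < y) :
    wordMap ω x - wordMap ω y = (-1) ^ ω.length * ((x - y) / (wordDen ω x * wordDen ω y)) := by
  have h1 := (wordDen_pos hω hx).1
  have h2 := (wordDen_pos hω hy).1
  rw [wordMap_eq_div hω hx, wordMap_eq_div hω hy, div_sub_div _ _ h1.ne' h2.ne',
    mul_comm (wordDen ω x) (wordNum ω y), wordNum_mul_wordDen_sub, mul_div_assoc]

theorem abs_wordMap_sub {ω : List ℕ} (hω : ∀ a ∈ ω, 1 ≤ a) {x y : ℝ} (hx : -1 < x)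
    (hy : -1 < y) :
    |wordMap ω x - wordMap ω y| = |x - y| / (wordDen ω x * wordDen ω y) := by
  have h1 := (wordDen_pos hω hx).1
  have h2 := (wordDen_pos hω hy).1
  rw [wordMap_sub hω hx hy, abs_mul, abs_pow, abs_neg, abs_one, one_pow, one_mul, abs_div,
    abs_of_pos (mul_pos h1 h2)]

theorem abs_wordMap_sub_le {ω : List ℕ} (hω : ∀ a ∈ ω, 1 ≤ a) {x y : ℝ}
    (hx : x ∈ Icc (0 : ℝ) 1) (hy : y ∈ Icc (0 : ℝ) 1) :
    |wordMap ω x - wordMap ω y| ≤ |x - y| / wordDen ω 0 ^ 2 := by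
  rw [abs_wordMap_sub hω (by linarith [hx.1]) (by linarith [hy.1])]
  have h0 := (wordDen_pos hω (by norm_num : (-1 : ℝ) < 0)).1
  rw [sq]
  have h1 := (wordDen_mem_Icc hω hx).1
  have h2 := (wordDen_mem_Icc hω hy).1
  exact div_le_div_of_nonneg_left (abs_nonneg _) (by positivity)
    (mul_le_mul h1 h2 h0.le (h0.le.trans h1))

theorem le_abs_wordMap_sub {ω : List ℕ} (hω : ∀ a ∈ ω, 1 ≤ a) {x y : ℝ}
    (hx : x ∈ Icc (-1 / 2 : ℝ) 1) (hy : y ∈ Icc (-1 / 2 : ℝ) 1) :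
    |x - y| / (4 * wordDen ω 0 ^ 2) ≤ |wordMap ω x - wordMap ω y| := by
  have hx' : -1 < x := by linarith [hx.1]
  have hy' : -1 < y := by linarith [hy.1]
  rw [abs_wordMap_sub hω hx' hy']
  have h0 := (wordDen_pos hω (by norm_num : (-1 : ℝ) < 0)).1
  have h1 := (wordDen_pos hω hx').1
  have h2 := (wordDen_pos hω hy').1
  have h3 : 4 * wordDen ω 0 ^ 2 = (2 * wordDen ω 0) * (2 * wordDen ω 0) := by ring
  rw [h3]
  have := wordDen_le_two_mul hω hx
  have := wordDen_le_two_mul hω hy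
  gcongr

theorem wordMap_mem_Icc {ω : List ℕ} (hω : ∀ a ∈ ω, 1 ≤ a) {x : ℝ} (hx : x ∈ Icc (0 : ℝ) 1) :
    wordMap ω x ∈ Icc (0 : ℝ) 1 := by
  induction ω with
  | nil => exact hx
  | cons a ω ih =>
    obtain ⟨h1, h2⟩ := ih fun b hb => hω b (List.mem_cons_of_mem _ hb)
    have ha : (1 : ℝ) ≤ a := by exact_mod_cast hω a List.mem_cons_self
    simp only [wordMap, gaussMap]
    exact ⟨by positivity, by rw [div_le_one (by linarith)]; linarith⟩

theorem gaussMap_mem_Ioo {a : ℕ} (ha : 1 ≤ a) {x : ℝ} (hx : x ∈ Ioo (0 : ℝ) 1) :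
    gaussMap a x ∈ Ioo (0 : ℝ) 1 := by
  have ha : (1 : ℝ) ≤ a := by exact_mod_cast ha
  have := hx.1
  simp only [gaussMap]
  exact ⟨by positivity, by rw [div_lt_one (by linarith)]; linarith⟩

theorem wordMap_mem_Ioo {ω : List ℕ} (hω : ∀ a ∈ ω, 1 ≤ a) {x : ℝ} (hx : x ∈ Ioo (0 : ℝ) 1) :
    wordMap ω x ∈ Ioo (0 : ℝ) 1 := by
  induction ω with
  | nil => exact hx
  | cons a ω ih =>
    exact gaussMap_mem_Ioo (hω a List.mem_cons_self)
      (ih fun b hb => hω b (List.mem_cons_of_mem _ hb))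

theorem hasDerivAt_gaussMap {a : ℕ} {x : ℝ} (hx : (a : ℝ) + x ≠ 0) :
    HasDerivAt (gaussMap a) (-1 / (a + x) ^ 2) x := by
  have h : HasDerivAt (fun y : ℝ => (a : ℝ) + y) 1 x := (hasDerivAt_id x).const_add _
  have h2 := h.inv hx
  have h3 : gaussMap a = (fun y : ℝ => (a : ℝ) + y)⁻¹ := by
    funext y; simp [gaussMap]
  rw [h3]
  exact h2

theorem hasDerivAt_wordMap {ω : List ℕ} (hω : ∀ a ∈ ω, 1 ≤ a) {x : ℝ} (hx : -1 < x) :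
    HasDerivAt (wordMap ω) ((-1) ^ ω.length / wordDen ω x ^ 2) x := by
  induction ω with
  | nil =>
    simp only [wordMap, wordDen, List.length_nil, pow_zero, one_pow, div_one]
    exact hasDerivAt_id' x
  | cons a ω ih =>
    have hω' : ∀ b ∈ ω, 1 ≤ b := fun b hb => hω b (List.mem_cons_of_mem _ hb)
    have h1 := (wordDen_pos hω hx).1
    have h2 := (wordDen_pos hω' hx).1
    rw [wordDen_cons hω' hx] at h1 ⊢
    have h3 : (a : ℝ) + wordMap ω x ≠ 0 := by
      rintro h; rw [h] at h1; simp at h1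
    have h4 := (hasDerivAt_gaussMap h3).comp x (ih hω')
    have h5 : (-1 : ℝ) ^ (a :: ω).length / (wordDen ω x * (a + wordMap ω x)) ^ 2
        = -1 / (a + wordMap ω x) ^ 2 * ((-1) ^ ω.length / wordDen ω x ^ 2) := by
      rw [List.length_cons, pow_succ]
      field_simp
    rw [h5]
    exact h4

theorem derivNorm_eq {ω : List ℕ} (hω : ∀ a ∈ ω, 1 ≤ a) :
    derivNorm ω = 1 / wordDen ω 0 ^ 2 := by
  have h0 := (wordDen_pos hω (by norm_num : (-1 : ℝ) < 0)).1
  have key (x : Icc (0 : ℝ) 1) : |deriv (wordMap ω) x| = 1 / wordDen ω x ^ 2 := by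
    rw [(hasDerivAt_wordMap hω (by linarith [x.2.1])).deriv, abs_div, abs_pow, abs_neg, abs_one,
      one_pow, abs_of_nonneg (sq_nonneg _)]
  have hle (x : Icc (0 : ℝ) 1) : |deriv (wordMap ω) x| ≤ 1 / wordDen ω 0 ^ 2 := by
    rw [key]
    have := (wordDen_mem_Icc hω x.2).1
    gcongr
  have : Nonempty (Icc (0 : ℝ) 1) := ⟨⟨0, by simp⟩⟩
  refine le_antisymm (ciSup_le hle) ?_
  refine le_trans ?_ (le_ciSup ⟨1 / wordDen ω 0 ^ 2, ?_⟩ (⟨0, by simp⟩ : Icc (0 : ℝ) 1))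
  · rw [key]
  · rintro _ ⟨x, rfl⟩; exact hle x

theorem derivNorm_singleton {a : ℕ} (ha : 1 ≤ a) : derivNorm [a] = 1 / (a : ℝ) ^ 2 := by
  rw [derivNorm_eq (by simpa using ha)]
  simp [wordDen, wordNum]

/-- The cylinder of `τ` has a neighbour across `wordMap τ 0`, namely the cylinder of a word with
the same denominator at `0`. -/
theorem exists_neighbor {σ : List ℕ} {c b : ℕ} (hσ : ∀ a ∈ σ ++ [c, b], 1 ≤ a) :
    ∃ τ : List ℕ, (∀ a ∈ τ, 1 ≤ a) ∧ wordDen τ 0 = wordDen (σ ++ [c, b]) 0 ∧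
      ∀ t ∈ Icc (0 : ℝ) 1, wordMap τ t = wordMap (σ ++ [c, b]) (-t / (1 + t)) := by
  have hc : 1 ≤ c := hσ c (by simp)
  have hb : 1 ≤ b := hσ b (by simp)
  have hσ' : ∀ a ∈ σ, 1 ≤ a := fun a ha => hσ a (by simp [ha])
  have h0 : (-1 : ℝ) < 0 := by norm_num
  have hcR : (1 : ℝ) ≤ c := by exact_mod_cast hc
  have hcb : ∀ a ∈ [c, b], 1 ≤ a := by simp [hc, hb]
  rcases hb.eq_or_lt with rfl | hb2
  · have hτ : ∀ a ∈ [c + 1], 1 ≤ a := by simp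
    refine ⟨σ ++ [c + 1], ?_, ?_, ?_⟩
    · intro a ha
      rcases List.mem_append.1 ha with h | h
      exacts [hσ' a h, hτ a h]
    · rw [(wordDen_append hσ' hτ h0).1, (wordDen_append hσ' hcb h0).1]
      simp [wordDen, wordNum, wordMap, gaussMap]
    · intro t ht
      rw [wordMap_append, wordMap_append]
      congr 1
      have := ht.1
      simp only [wordMap, gaussMap]
      push_cast
      have h1 : 1 + -t / (1 + t) = 1 / (1 + t) := by field_simp; ring
      rw [h1, one_div_one_div]
      ring
  · obtain ⟨d, rfl⟩ : ∃ d, b = d + 1 := ⟨b - 1, by omega⟩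
    have hτ : ∀ a ∈ [c, d, 1], 1 ≤ a := by simp [hc]; omega
    have hd : (1 : ℝ) ≤ d := by exact_mod_cast (by omega : 1 ≤ d)
    refine ⟨σ ++ [c, d, 1], ?_, ?_, ?_⟩
    · intro a ha
      rcases List.mem_append.1 ha with h | h
      exacts [hσ' a h, hτ a h]
    · rw [(wordDen_append hσ' hτ h0).1, (wordDen_append hσ' hcb h0).1]
      simp [wordDen, wordNum, wordMap, gaussMap]
    · intro t ht
      rw [wordMap_append, wordMap_append]
      congr 1
      have := ht.1
      simp only [wordMap, gaussMap]
      push_cast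
      have h1 : (d : ℝ) + 1 + -t / (1 + t) = d + 1 / (1 + t) := by field_simp; ring
      rw [h1]

theorem continuousOn_wordMap {ω : List ℕ} (hω : ∀ a ∈ ω, 1 ≤ a) :
    ContinuousOn (wordMap ω) (Ioi (-1)) := fun _ hx =>
  (hasDerivAt_wordMap hω hx).continuousAt.continuousWithinAt

theorem measurable_gaussMap (a : ℕ) : Measurable (gaussMap a) := by
  unfold gaussMap; fun_prop

theorem measurable_wordMap (ω : List ℕ) : Measurable (wordMap ω) := by
  induction ω with
  | nil => exact measurable_id
  | cons a ω ih => exact (measurable_gaussMap a).comp ih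

theorem exists_wordMap_eq_of_abs_sub_le {τ : List ℕ} (hτ : ∀ a ∈ τ, 1 ≤ a) {y z s : ℝ}
    (hy : 0 ≤ y) (hy' : y ≤ 2 / 3) (hs : s ≤ 1 / 16)
    (hz : |z - wordMap τ y| ≤ s / wordDen τ 0 ^ 2) :
    ∃ v ∈ Icc (-1 / 2 : ℝ) 1, wordMap τ v = z ∧ |v - y| ≤ 4 * s := by
  have h0 := (wordDen_pos hτ (by norm_num : (-1 : ℝ) < 0)).1
  have hQ : 0 < wordDen τ 0 ^ 2 := by positivity
  have hymem : y ∈ Icc (-1 / 2 : ℝ) 1 := ⟨by linarith, by linarith⟩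
  have hlow : s / wordDen τ 0 ^ 2 ≤ |wordMap τ (-1 / 2) - wordMap τ y| := by
    refine le_trans ?_ (le_abs_wordMap_sub hτ (by norm_num) hymem)
    rw [div_le_div_iff₀ hQ (by positivity), abs_of_nonpos (by linarith)]
    nlinarith
  have hhigh : s / wordDen τ 0 ^ 2 ≤ |wordMap τ 1 - wordMap τ y| := by
    refine le_trans ?_ (le_abs_wordMap_sub hτ (by norm_num) hymem)
    rw [div_le_div_iff₀ hQ (by positivity), abs_of_nonneg (by linarith)]
    nlinarith
  have hcont : ContinuousOn (wordMap τ) (Icc (-1 / 2 : ℝ) 1) :=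
    (continuousOn_wordMap hτ).mono fun u hu => by
      simp only [mem_Ioi]; linarith [hu.1]
  have e1 := wordMap_sub hτ (x := -1 / 2) (y := y) (by norm_num) (by linarith)
  have e2 := wordMap_sub hτ (x := 1) (y := y) (by norm_num) (by linarith)
  have hdy := (wordDen_pos hτ (by linarith : -1 < y)).1
  have hd1 := (wordDen_pos hτ (by norm_num : (-1 : ℝ) < 1)).1
  have hd2 := (wordDen_pos hτ (by norm_num : (-1 : ℝ) < -1 / 2)).1
  have n1 : (-1 / 2 - y) / (wordDen τ (-1 / 2) * wordDen τ y) ≤ 0 :=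
    div_nonpos_of_nonpos_of_nonneg (by linarith) (by positivity)
  have n2 : 0 ≤ (1 - y) / (wordDen τ 1 * wordDen τ y) :=
    div_nonneg (by linarith) (by positivity)
  have hzz := abs_le.1 hz
  have hmem : z ∈ wordMap τ '' Icc (-1 / 2 : ℝ) 1 := by
    rcases neg_one_pow_eq_or ℝ τ.length with h | h
    · rw [h, one_mul] at e1 e2
      rw [e1, abs_of_nonpos n1] at hlow
      rw [e2, abs_of_nonneg n2] at hhigh
      exact intermediate_value_Icc (by norm_num) hcont ⟨by linarith, by linarith⟩
    · rw [h, neg_one_mul] at e1 e2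
      rw [e1, abs_of_nonneg (by linarith)] at hlow
      rw [e2, abs_of_nonpos (by linarith)] at hhigh
      exact intermediate_value_Icc' (by norm_num) hcont ⟨by linarith, by linarith⟩
  obtain ⟨v, hv, rfl⟩ := hmem
  refine ⟨v, hv, rfl, ?_⟩
  have h := (le_abs_wordMap_sub hτ hv hymem).trans hz
  rw [div_le_div_iff₀ (by positivity) hQ] at h
  nlinarith

/-- The initial word of length `n` of the sequence `ω`. -/
def prefixWord (ω : ℕ → ℕ) (n : ℕ) : List ℕ := List.ofFn fun i : Fin n => ω i

theorem prefixWord_succ (ω : ℕ → ℕ) (n : ℕ) :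
    prefixWord ω (n + 1) = prefixWord ω n ++ [ω n] := by
  rw [prefixWord, List.ofFn_succ_last]
  simp [prefixWord]

theorem prefixWord_succ' (ω : ℕ → ℕ) (n : ℕ) :
    prefixWord ω (n + 1) = ω 0 :: prefixWord (fun i => ω (i + 1)) n := by
  simp [prefixWord, List.ofFn_succ]

theorem forall_mem_prefixWord {ω : ℕ → ℕ} {p : ℕ → Prop} (h : ∀ n, p (ω n)) (n : ℕ) :
    ∀ a ∈ prefixWord ω n, p a := by
  intro a ha
  obtain ⟨i, rfl⟩ := (List.mem_ofFn' _ _).1 ha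
  exact h i

theorem one_le_wordDen_zero {τ : List ℕ} (hτ : ∀ a ∈ τ, 1 ≤ a) : 1 ≤ wordDen τ 0 := by
  induction τ with
  | nil => simp [wordDen]
  | cons a τ ih =>
    have hτ' : ∀ b ∈ τ, 1 ≤ b := fun b hb => hτ b (List.mem_cons_of_mem _ hb)
    have h1 := ih hτ'
    have ha : (1 : ℝ) ≤ a := by exact_mod_cast hτ a List.mem_cons_self
    have h2 := (wordMap_mem_Icc hτ' (by norm_num : (0 : ℝ) ∈ Icc (0 : ℝ) 1)).1
    rw [wordDen_cons hτ' (by norm_num)]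
    nlinarith

theorem wordDen_concat {τ : List ℕ} (hτ : ∀ a ∈ τ, 1 ≤ a) {a : ℕ} (ha : 1 ≤ a) :
    wordDen (τ ++ [a]) 0 ∈ Icc (a * wordDen τ 0) (2 * (a * wordDen τ 0)) := by
  have ha' : (1 : ℝ) ≤ a := by exact_mod_cast ha
  rw [(wordDen_append hτ (by simpa using ha) (by norm_num)).1]
  have h := wordDen_mem_Icc hτ (x := wordMap [a] 0)
    (wordMap_mem_Icc (by simpa using ha) (by norm_num))
  have e : wordDen [a] 0 = a := by simp [wordDen, wordNum]
  rw [e]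
  constructor <;> nlinarith [h.1, h.2]

theorem two_mul_wordDen_le {τ : List ℕ} {c b : ℕ} (hτ : ∀ a ∈ τ ++ [c, b], 1 ≤ a) :
    2 * wordDen τ 0 ≤ wordDen (τ ++ [c, b]) 0 := by
  have hcb : ∀ a ∈ [c, b], 1 ≤ a := fun a ha => hτ a (List.mem_append_right _ ha)
  have hτ' : ∀ a ∈ τ, 1 ≤ a := fun a ha => hτ a (List.mem_append_left _ ha)
  have hc : (1 : ℝ) ≤ c := by exact_mod_cast hcb c (by simp)
  have hb : (1 : ℝ) ≤ b := by exact_mod_cast hcb b (by simp)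
  have h0 := one_le_wordDen_zero hτ'
  rw [(wordDen_append hτ' hcb (by norm_num)).1]
  have h := (wordDen_mem_Icc hτ' (wordMap_mem_Icc hcb (by norm_num : (0 : ℝ) ∈ Icc (0 : ℝ) 1))).1
  have e : wordDen [c, b] 0 = c * b + 1 := by simp [wordDen, wordNum]
  rw [e]
  have : (2 : ℝ) ≤ c * b + 1 := by nlinarith
  exact mul_le_mul this h (by linarith) (by linarith)

theorem le_two_mul_wordDen_prefixWord {ω : ℕ → ℕ} (hω : ∀ n, 1 ≤ ω n) (n : ℕ) :
    (n : ℝ) ≤ 2 * wordDen (prefixWord ω n) 0 := by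
  induction n using Nat.twoStepInduction with
  | zero => simp [prefixWord, wordDen]
  | one =>
    have := one_le_wordDen_zero (forall_mem_prefixWord hω 1)
    push_cast
    linarith
  | more n ih _ =>
    have h1 := one_le_wordDen_zero (forall_mem_prefixWord hω n)
    have e : prefixWord ω (n + 2) = prefixWord ω n ++ [ω n, ω (n + 1)] := by
      rw [prefixWord_succ, prefixWord_succ]; simp
    have h2 := two_mul_wordDen_le (e ▸ forall_mem_prefixWord hω (n + 2))
    rw [e]
    push_cast
    linarith

theorem tendsto_one_div_wordDen_sq {ω : ℕ → ℕ} (hω : ∀ n, 1 ≤ ω n) :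
    Tendsto (fun n => 1 / wordDen (prefixWord ω n) 0 ^ 2) atTop (𝓝 0) := by
  have h : Tendsto (fun n => wordDen (prefixWord ω n) 0) atTop atTop := by
    refine tendsto_atTop_mono (fun n => ?_)
      (tendsto_natCast_atTop_atTop.atTop_div_const (by norm_num : (0 : ℝ) < 2))
    linarith [le_two_mul_wordDen_prefixWord hω n]
  exact ((tendsto_pow_atTop two_ne_zero).comp h).const_div_atTop 1

theorem exists_wordMap_prefixWord_add {ω : ℕ → ℕ} (hω : ∀ n, 1 ≤ ω n) (n m : ℕ) {u : ℝ}
    (hu : u ∈ Icc (0 : ℝ) 1) :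
    ∃ v ∈ Icc (0 : ℝ) 1, wordMap (prefixWord ω (n + m)) u = wordMap (prefixWord ω n) v := by
  induction m generalizing u with
  | zero => exact ⟨u, hu, rfl⟩
  | succ m ih =>
    rw [← add_assoc, prefixWord_succ, wordMap_append]
    exact ih (wordMap_mem_Icc (by simpa using hω _) hu)

theorem tendsto_codingMap {ω : ℕ → ℕ} (hω : ∀ n, 1 ≤ ω n) :
    Tendsto (fun n => wordMap (prefixWord ω n) 0) atTop (𝓝 (codingMap ω)) := by
  have h0 : (0 : ℝ) ∈ Icc (0 : ℝ) 1 := by norm_num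
  have hc : CauchySeq fun n => wordMap (prefixWord ω n) 0 := by
    refine cauchySeq_of_le_tendsto_0 (fun n => 1 / wordDen (prefixWord ω n) 0 ^ 2) ?_
      (tendsto_one_div_wordDen_sq hω)
    intro n m N hn hm
    obtain ⟨i, rfl⟩ := Nat.exists_eq_add_of_le hn
    obtain ⟨j, rfl⟩ := Nat.exists_eq_add_of_le hm
    obtain ⟨u, hu, e1⟩ := exists_wordMap_prefixWord_add hω N i h0
    obtain ⟨v, hv, e2⟩ := exists_wordMap_prefixWord_add hω N j h0
    rw [e1, e2, Real.dist_eq]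
    refine (abs_wordMap_sub_le (forall_mem_prefixWord hω N) hu hv).trans ?_
    gcongr
    exact abs_le.2 ⟨by linarith [hu.1, hv.2], by linarith [hu.2, hv.1]⟩
  exact hc.tendsto_limUnder

theorem codingMap_eq_gaussMap {ω : ℕ → ℕ} (hω : ∀ n, 1 ≤ ω n) :
    codingMap ω = gaussMap (ω 0) (codingMap fun i => ω (i + 1)) ∧ codingMap ω ∈ Icc (0 : ℝ) 1 := by
  have hmem {η : ℕ → ℕ} (hη : ∀ n, 1 ≤ η n) : codingMap η ∈ Icc (0 : ℝ) 1 :=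
    isClosed_Icc.mem_of_tendsto (tendsto_codingMap hη)
      (Eventually.of_forall fun n =>
        wordMap_mem_Icc (forall_mem_prefixWord hη n) (by norm_num))
  refine ⟨?_, hmem hω⟩
  have hω' : ∀ n, 1 ≤ ω (n + 1) := fun n => hω (n + 1)
  have h1 := (tendsto_codingMap hω).comp (tendsto_add_atTop_nat 1)
  have ha : (1 : ℝ) ≤ ω 0 := by exact_mod_cast hω 0
  have h2 := (hasDerivAt_gaussMap (a := ω 0) (x := codingMap fun i => ω (i + 1))
    (by linarith [(hmem hω').1])).continuousAt.tendsto.comp (tendsto_codingMap hω')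
  refine tendsto_nhds_unique h1 (h2.congr fun n => ?_)
  simp only [Function.comp_apply, prefixWord_succ', wordMap]

theorem codingMap_mem_Ioo {ω : ℕ → ℕ} (hω : ∀ n, 1 ≤ ω n) : codingMap ω ∈ Ioo (0 : ℝ) 1 := by
  have hpos {η : ℕ → ℕ} (hη : ∀ n, 1 ≤ η n) : 0 < codingMap η := by
    have h := (codingMap_eq_gaussMap (ω := fun i => η (i + 1)) fun n => hη (n + 1)).2.1
    have ha : (1 : ℝ) ≤ η 0 := by exact_mod_cast hη 0
    rw [(codingMap_eq_gaussMap hη).1, gaussMap]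
    positivity
  refine ⟨hpos hω, ?_⟩
  have h := hpos (η := fun i => ω (i + 1)) fun n => hω (n + 1)
  have ha : (1 : ℝ) ≤ ω 0 := by exact_mod_cast hω 0
  rw [(codingMap_eq_gaussMap hω).1, gaussMap, div_lt_one (by linarith)]
  linarith

theorem codingMap_shift {ω : ℕ → ℕ} (hω : ∀ n, 1 ≤ ω n) (n : ℕ) :
    codingMap (fun i => ω (n + i)) = gaussMap (ω n) (codingMap fun i => ω (n + 1 + i)) := by
  rw [(codingMap_eq_gaussMap fun i => hω (n + i)).1, add_zero]
  congr 3
  funext i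
  congr 1
  ring

theorem codingMap_eq_wordMap {ω : ℕ → ℕ} (hω : ∀ n, 1 ≤ ω n) (n : ℕ) :
    codingMap ω = wordMap (prefixWord ω n) (codingMap fun i => ω (n + i)) := by
  induction n with
  | zero => simp [prefixWord, wordMap]
  | succ n ih =>
    rw [prefixWord_succ, wordMap_append, ih, codingMap_shift hω n]
    rfl

theorem limitSet_subset_Ioo {E : Set ℕ} (hE : 0 ∉ E) : limitSet E ⊆ Ioo 0 1 := by
  rintro _ ⟨ω, hω, rfl⟩
  exact codingMap_mem_Ioo fun n =>
    Nat.one_le_iff_ne_zero.2 fun h => hE (h ▸ hω n)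

theorem eq_of_gaussMap_eq {a b : ℕ} {x y : ℝ} (ha : 1 ≤ a) (hb : 1 ≤ b) (hx : x ∈ Icc (0 : ℝ) 1)
    (hy : y ∈ Ioo (0 : ℝ) 1) (h : gaussMap a x = gaussMap b y) : a = b ∧ x = y := by
  have ha' : (1 : ℝ) ≤ a := by exact_mod_cast ha
  have hb' : (1 : ℝ) ≤ b := by exact_mod_cast hb
  have h1 : (a : ℝ) + x = b + y := by
    simp only [gaussMap] at h
    have := hx.1; have := hy.1
    field_simp at h
    linarith
  have h2 : a = b := by
    have l1 : a < b + 1 := by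
      have : (a : ℝ) < b + 1 := by linarith [hx.1, hy.2]
      exact_mod_cast this
    have l2 : b < a + 1 := by
      have : (b : ℝ) < a + 1 := by linarith [hx.2, hy.1]
      exact_mod_cast this
    omega
  subst h2
  exact ⟨rfl, by linarith⟩

theorem wordMap_zero_notMem_limitSet {E : Set ℕ} (hE : 0 ∉ E) {τ : List ℕ}
    (hτ : ∀ a ∈ τ, 1 ≤ a) : wordMap τ 0 ∉ limitSet E := by
  induction τ with
  | nil => exact fun h => lt_irrefl _ (limitSet_subset_Ioo hE h).1
  | cons a τ ih =>
    have hτ' : ∀ b ∈ τ, 1 ≤ b := fun b hb => hτ b (List.mem_cons_of_mem _ hb)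
    rintro ⟨η, hη, h⟩
    have hη1 (n : ℕ) : 1 ≤ η n := Nat.one_le_iff_ne_zero.2 fun h => hE (h ▸ hη n)
    rw [(codingMap_eq_gaussMap hη1).1] at h
    have h2 := (eq_of_gaussMap_eq (hτ a List.mem_cons_self) (hη1 0)
      (wordMap_mem_Icc hτ' (by norm_num)) (codingMap_mem_Ioo fun n => hη1 (n + 1)) h.symm).2
    exact ih hτ' ⟨_, fun n => hη (n + 1), h2.symm⟩

/-- Every sufficiently small scale is comparable to one between two consecutive cylinders. -/
theorem exists_scale {ω : ℕ → ℕ} (hω : ∀ n, 1 ≤ ω n) (N : ℕ) {ρ : ℝ} (hρ : 0 < ρ)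
    (hρN : ρ ≤ 1 / wordDen (prefixWord ω N) 0 ^ 2) :
    ∃ n ≥ N, ∃ r, 1 / (ω n : ℝ) ^ 2 ≤ r ∧ r ≤ 1 ∧ ρ ≤ r / wordDen (prefixWord ω n) 0 ^ 2 ∧
      r / wordDen (prefixWord ω n) 0 ^ 2 ≤ 4 * ρ := by
  have hex : ∃ j, 1 / wordDen (prefixWord ω (N + j + 1)) 0 ^ 2 < ρ := by
    have h := (tendsto_one_div_wordDen_sq hω).eventually (gt_mem_nhds hρ)
    obtain ⟨M, hM⟩ := eventually_atTop.1 h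
    exact ⟨M, hM _ (by omega)⟩
  classical
  have h1 := Nat.find_spec hex
  have h2 : ρ ≤ 1 / wordDen (prefixWord ω (N + Nat.find hex)) 0 ^ 2 := by
    rcases Nat.eq_zero_or_pos (Nat.find hex) with h | h
    · rwa [h]
    · have := Nat.find_min hex (Nat.sub_lt h one_pos)
      have e : N + (Nat.find hex - 1) + 1 = N + Nat.find hex := by omega
      rw [e] at this
      exact not_lt.1 this
  set n := N + Nat.find hex
  have ha : (1 : ℝ) ≤ ω n := by exact_mod_cast hω n
  have hQ := one_le_wordDen_zero (forall_mem_prefixWord hω n)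
  have hQ' := (wordDen_concat (forall_mem_prefixWord hω n) (hω n)).2
  have hQ1 := one_le_wordDen_zero (forall_mem_prefixWord hω (n + 1))
  rw [← prefixWord_succ] at hQ'
  set Q := wordDen (prefixWord ω n) 0
  set Q' := wordDen (prefixWord ω (n + 1)) 0
  have hQ2 : 0 < Q ^ 2 := by positivity
  have h3 : 1 / (ω n : ℝ) ^ 2 ≤ 4 * ρ * Q ^ 2 := by
    have h4 : 1 < ρ * Q' ^ 2 := by rwa [div_lt_iff₀ (by positivity)] at h1
    have h5 : Q' ^ 2 ≤ (2 * (ω n * Q)) ^ 2 := by gcongr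
    rw [div_le_iff₀ (by positivity)]
    nlinarith
  rw [le_div_iff₀ hQ2] at h2
  refine ⟨n, by omega, max (ρ * Q ^ 2) (1 / (ω n : ℝ) ^ 2), le_max_right _ _, ?_, ?_, ?_⟩
  · refine max_le h2 ?_
    rw [div_le_one (by positivity)]
    nlinarith
  · rw [le_div_iff₀ hQ2]; exact le_max_left _ _
  · rw [div_le_iff₀ hQ2]
    exact max_le (by nlinarith) h3

theorem codingMap_shift_mem {ω : ℕ → ℕ} (hω : ∀ n, 1 ≤ ω n) (n : ℕ) :
    codingMap (fun i => ω (n + i)) ∈ cyl [ω n] ∧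
      ∀ w ∈ cyl [ω n], |w - codingMap fun i => ω (n + i)| ≤ 1 / (ω n : ℝ) ^ 2 := by
  have h := codingMap_mem_Ioo fun i => hω (n + 1 + i)
  have hmem : (codingMap fun i => ω (n + 1 + i)) ∈ Icc (0 : ℝ) 1 := Ioo_subset_Icc_self h
  rw [codingMap_shift hω n]
  refine ⟨⟨_, hmem, rfl⟩, ?_⟩
  rintro _ ⟨u, hu, rfl⟩
  have := abs_wordMap_sub_le (ω := [ω n]) (by simpa using hω n) hu hmem
  refine this.trans ?_
  have e : wordDen [ω n] 0 = ω n := by simp [wordDen, wordNum]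
  rw [e]
  gcongr
  exact abs_le.2 ⟨by linarith [hu.1, hmem.2], by linarith [hu.2, hmem.1]⟩

theorem IsConformal.ae_mem_Ioo {E : Set ℕ} (hE : 0 ∉ E) {δ : ℝ} {μ : Measure ℝ}
    (hμ : IsConformal E δ μ) : ∀ᵐ x ∂μ, x ∈ Ioo (0 : ℝ) 1 :=
  measure_mono_null (compl_subset_compl.2 (limitSet_subset_Ioo hE)) hμ.2.1

open Classical in
/-- The Jacobian of `wordMap τ` with respect to a `δ`-conformal measure on the limit set of `E`;
it vanishes if `τ` is not a word over `E`. -/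
def wordWeight (E : Set ℕ) (δ : ℝ) (τ : List ℕ) (x : ℝ) : ℝ≥0∞ :=
  if τ ∈ words E then ENNReal.ofReal ((1 / wordDen τ x ^ 2) ^ δ) else 0

theorem measurable_wordWeight (E : Set ℕ) (δ : ℝ) (τ : List ℕ) :
    Measurable (wordWeight E δ τ) := by
  have h : wordDen τ = fun x => wordDen τ 0 + x * (wordDen τ 1 - wordDen τ 0) :=
    funext fun x => (wordDen_affine τ x).1
  have h' : Measurable (wordDen τ) := by rw [h]; fun_prop
  unfold wordWeight
  split_ifs
  · fun_prop
  · exact measurable_const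

theorem measurableSet_wordMap_image {τ : List ℕ} (hτ : ∀ a ∈ τ, 1 ≤ a) {B : Set ℝ}
    (hB : MeasurableSet B) (hBI : B ⊆ Ioo 0 1) : MeasurableSet (wordMap τ '' B) := by
  refine hB.image_of_continuousOn_injOn ((continuousOn_wordMap hτ).mono fun x hx => ?_)
    fun x hx y hy h => ?_
  · simp only [mem_Ioi]; linarith [(hBI hx).1]
  · have hx' := hBI hx
    have hy' := hBI hy
    have h1 := le_abs_wordMap_sub hτ (x := x) (y := y) ⟨by linarith [hx'.1], hx'.2.le⟩
      ⟨by linarith [hy'.1], hy'.2.le⟩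
    have h0 := one_le_wordDen_zero hτ
    rw [h, sub_self, abs_zero, div_le_iff₀ (by positivity), zero_mul] at h1
    linarith [abs_nonpos_iff.1 h1]

theorem IsConformal.restrict_gaussMap_image {E : Set ℕ} (hE : 0 ∉ E) {δ : ℝ} (hδ : 0 ≤ δ)
    {μ : Measure ℝ} (hμ : IsConformal E δ μ) {a : ℕ} (ha : 1 ≤ a) {B : Set ℝ}
    (hB : MeasurableSet B) (hBI : B ⊆ Ioo 0 1) :
    μ.restrict (gaussMap a '' B) =
      ((μ.restrict B).withDensity (wordWeight E δ [a])).map (gaussMap a) := by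
  have := hμ.1
  have hI := hμ.ae_mem_Ioo hE
  have hone {b : ℕ} (hb : b ∈ E) : 1 ≤ b := Nat.one_le_iff_ne_zero.2 fun h => hE (h ▸ hb)
  ext S hS
  have hmeas : MeasurableSet (S ∩ gaussMap a '' B) :=
    hS.inter (measurableSet_wordMap_image (τ := [a]) (by simpa using ha) hB hBI)
  have hsub : S ∩ gaussMap a '' B ⊆ Icc 0 1 := by
    rintro _ ⟨-, x, hx, rfl⟩
    exact Ioo_subset_Icc_self (gaussMap_mem_Ioo ha (hBI hx))
  rw [Measure.restrict_apply hS, Measure.map_apply (measurable_gaussMap a) hS,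
    withDensity_apply _ (measurable_gaussMap a hS),
    Measure.restrict_restrict (measurable_gaussMap a hS), hμ.2.2 _ hsub hmeas]
  have hne (b : E) (hb : (b : ℕ) ≠ a) : ENNReal.ofReal
      (∫ x in gaussMap b ⁻¹' (S ∩ gaussMap a '' B), |deriv (gaussMap b) x| ^ δ ∂μ) = 0 := by
    rw [setIntegral_measure_zero, ENNReal.ofReal_zero]
    refine measure_mono_null ?_ hI
    rintro x ⟨-, u, hu, h⟩ hx
    exact hb (eq_of_gaussMap_eq (hone b.2) ha (Ioo_subset_Icc_self hx) (hBI hu) h.symm).1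
  by_cases haE : a ∈ E
  · have hw : ∀ x ∈ Ioo (0 : ℝ) 1, ENNReal.ofReal (|deriv (gaussMap a) x| ^ δ)
        = wordWeight E δ [a] x := by
      intro x hx
      have ha' : (1 : ℝ) ≤ a := by exact_mod_cast ha
      have : (0 : ℝ) < a + x := by linarith [hx.1]
      rw [wordWeight, if_pos (by simpa [words] using haE), (hasDerivAt_gaussMap this.ne').deriv,
        abs_div, abs_neg, abs_one, abs_of_nonneg (sq_nonneg _)]
      simp [wordDen, wordNum]
    have hset : gaussMap a ⁻¹' (S ∩ gaussMap a '' B) =ᵐ[μ] (gaussMap a ⁻¹' S ∩ B : Set ℝ) := by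
      filter_upwards [hI] with x hx
      refine propext ⟨?_, fun h => ⟨h.1, x, h.2, rfl⟩⟩
      rintro ⟨h1, u, hu, h⟩
      have := (eq_of_gaussMap_eq ha ha (Ioo_subset_Icc_self (hBI hu)) hx h).2
      exact ⟨h1, this ▸ hu⟩
    rw [tsum_eq_single ⟨a, haE⟩ fun b hb => hne b fun h => hb (Subtype.ext h)]
    rw [setIntegral_congr_set hset, ofReal_integral_eq_lintegral_ofReal]
    · refine setLIntegral_congr_fun ((measurable_gaussMap a hS).inter hB) fun x hx => ?_
      exact hw x (hBI hx.2)
    · refine (integrable_const (1 : ℝ)).mono'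
        (((measurable_deriv _).abs.pow_const δ).aestronglyMeasurable) ?_
      refine (ae_restrict_of_ae hI).mono fun x hx => ?_
      have ha' : (1 : ℝ) ≤ a := by exact_mod_cast ha
      have hax : (1 : ℝ) ≤ a + x := by linarith [hx.1]
      rw [Real.norm_of_nonneg (by positivity), (hasDerivAt_gaussMap (by linarith)).deriv,
        abs_div, abs_neg, abs_one, abs_of_nonneg (sq_nonneg _)]
      refine Real.rpow_le_one (by positivity) ?_ hδ
      rw [div_le_one (by positivity)]
      nlinarith
    · exact Eventually.of_forall fun x => by positivity
  · have hw : wordWeight E δ [a] = 0 := by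
      funext x
      rw [wordWeight, if_neg (by simpa [words] using haE)]
      rfl
    rw [hw]
    simp only [Pi.zero_apply, lintegral_zero, ENNReal.tsum_eq_zero]
    exact fun b => hne b fun h => haE (h ▸ b.2)

theorem wordWeight_cons {E : Set ℕ} {δ : ℝ} {a : ℕ} {τ : List ℕ} (hτ : ∀ b ∈ a :: τ, 1 ≤ b)
    {x : ℝ} (hx : x ∈ Ioo (0 : ℝ) 1) :
    wordWeight E δ (a :: τ) x = wordWeight E δ [a] (wordMap τ x) * wordWeight E δ τ x := by
  have hτ' : ∀ b ∈ τ, 1 ≤ b := fun b hb => hτ b (List.mem_cons_of_mem _ hb)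
  have hx' : -1 < x := by linarith [hx.1]
  have h1 := (wordMap_mem_Ioo hτ' hx).1
  have h2 := (wordDen_pos hτ' hx').1
  by_cases ha : a ∈ E
  · by_cases hE : τ ∈ words E
    · have e : wordDen [a] (wordMap τ x) = a + wordMap τ x := by simp [wordDen, wordNum]
      have hc : a :: τ ∈ words E := List.forall_mem_cons.2 ⟨ha, hE⟩
      have hs : [a] ∈ words E := List.forall_mem_singleton.2 ha
      rw [wordWeight, wordWeight, wordWeight, if_pos hE, if_pos hc, if_pos hs,
        wordDen_cons hτ' hx', e,
        ← ENNReal.ofReal_mul (by positivity), ← Real.mul_rpow (by positivity) (by positivity)]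
      congr 2
      field_simp
    · rw [wordWeight, if_neg fun h => hE fun b hb => h b (List.mem_cons_of_mem _ hb),
        wordWeight, wordWeight, if_neg hE, mul_zero]
  · rw [wordWeight, if_neg fun h => ha (h a List.mem_cons_self), wordWeight,
      if_neg fun h => ha (h a List.mem_cons_self), zero_mul]

/-- Change of variables along `wordMap τ` for a conformal measure. -/
theorem IsConformal.lintegral_wordMap_image {E : Set ℕ} (hE : 0 ∉ E) {δ : ℝ} (hδ : 0 ≤ δ)
    {μ : Measure ℝ} (hμ : IsConformal E δ μ) {τ : List ℕ} (hτ : ∀ a ∈ τ, 1 ≤ a)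
    {g : ℝ → ℝ≥0∞} (hg : Measurable g) :
    ∫⁻ z in wordMap τ '' Ioo 0 1, g z ∂μ =
      ∫⁻ x in Ioo 0 1, g (wordMap τ x) * wordWeight E δ τ x ∂μ := by
  induction τ generalizing g with
  | nil =>
    have h : wordWeight E δ [] = 1 := by
      funext x
      rw [wordWeight, if_pos (by simp [words])]
      simp [wordDen]
    simp [wordMap, h]
  | cons a τ ih =>
    have hτ' : ∀ b ∈ τ, 1 ≤ b := fun b hb => hτ b (List.mem_cons_of_mem _ hb)
    have himg : wordMap (a :: τ) '' Ioo 0 1 = gaussMap a '' (wordMap τ '' Ioo 0 1) := by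
      rw [image_image]; rfl
    have hsub : wordMap τ '' Ioo 0 1 ⊆ Ioo 0 1 := by
      rintro _ ⟨x, hx, rfl⟩
      exact wordMap_mem_Ioo hτ' hx
    have hw := measurable_wordWeight E δ [a]
    have hg' : Measurable fun x => g (gaussMap a x) := hg.comp (measurable_gaussMap a)
    rw [himg, hμ.restrict_gaussMap_image hE hδ (hτ a List.mem_cons_self)
      (measurableSet_wordMap_image hτ' measurableSet_Ioo Subset.rfl) hsub,
      lintegral_map hg (measurable_gaussMap a),
      lintegral_withDensity_eq_lintegral_mul _ hw hg', ih hτ' (hw.mul hg')]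
    refine setLIntegral_congr_fun measurableSet_Ioo fun x hx => ?_
    simp only [Pi.mul_apply, wordWeight_cons hτ hx, wordMap]
    ring

theorem IsConformal.measure_inter_image {E : Set ℕ} (hE : 0 ∉ E) {δ : ℝ} (hδ : 0 ≤ δ)
    {μ : Measure ℝ} (hμ : IsConformal E δ μ) {τ : List ℕ} (hτ : ∀ a ∈ τ, 1 ≤ a) {S : Set ℝ}
    (hS : MeasurableSet S) :
    μ (S ∩ wordMap τ '' Ioo 0 1) =
      ∫⁻ x in wordMap τ ⁻¹' S ∩ Ioo 0 1, wordWeight E δ τ x ∂μ := by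
  have hS' := measurable_wordMap τ hS
  have h := hμ.lintegral_wordMap_image hE hδ hτ (measurable_one.indicator hS)
  rw [lintegral_indicator_one hS, Measure.restrict_apply hS] at h
  rw [h, ← Measure.restrict_restrict hS', ← lintegral_indicator hS']
  refine lintegral_congr fun x => ?_
  by_cases hx : wordMap τ x ∈ S
  · simp [indicator, hx]
  · simp [indicator, hx]

theorem IsConformal.measure_inter_image_le {E : Set ℕ} (hE : 0 ∉ E) {δ : ℝ} (hδ : 0 ≤ δ)
    {μ : Measure ℝ} (hμ : IsConformal E δ μ) {τ : List ℕ} (hτ : ∀ a ∈ τ, 1 ≤ a) {S : Set ℝ}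
    (hS : MeasurableSet S) :
    μ (S ∩ wordMap τ '' Ioo 0 1) ≤
      ENNReal.ofReal ((1 / wordDen τ 0 ^ 2) ^ δ) * μ (wordMap τ ⁻¹' S ∩ Ioo 0 1) := by
  have hS' := (measurable_wordMap τ hS).inter (measurableSet_Ioo (a := (0 : ℝ)) (b := 1))
  rw [hμ.measure_inter_image hE hδ hτ hS, ← setLIntegral_const]
  refine setLIntegral_mono' hS' fun x hx => ?_
  rw [wordWeight]
  split_ifs
  · have h := (wordDen_mem_Icc hτ (Ioo_subset_Icc_self hx.2)).1
    have h0 := one_le_wordDen_zero hτ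
    gcongr
  · exact zero_le

theorem IsConformal.le_measure_inter_image {E : Set ℕ} (hE : 0 ∉ E) {δ : ℝ} (hδ : 0 ≤ δ)
    {μ : Measure ℝ} (hμ : IsConformal E δ μ) {τ : List ℕ} (hτ : τ ∈ words E) {S : Set ℝ}
    (hS : MeasurableSet S) :
    ENNReal.ofReal ((1 / (4 * wordDen τ 0 ^ 2)) ^ δ) * μ (wordMap τ ⁻¹' S ∩ Ioo 0 1) ≤
      μ (S ∩ wordMap τ '' Ioo 0 1) := by
  have hS' := (measurable_wordMap τ hS).inter (measurableSet_Ioo (a := (0 : ℝ)) (b := 1))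
  have hτ1 : ∀ a ∈ τ, 1 ≤ a := fun a ha =>
    Nat.one_le_iff_ne_zero.2 fun h => hE (h ▸ hτ a ha)
  rw [hμ.measure_inter_image hE hδ hτ1 hS, ← setLIntegral_const]
  refine setLIntegral_mono' hS' fun x hx => ?_
  rw [wordWeight, if_pos hτ]
  have h := (wordDen_mem_Icc hτ1 (Ioo_subset_Icc_self hx.2)).2
  have h0 := (wordDen_pos hτ1 (by linarith [hx.2.1] : -1 < x)).1
  have h2 : 4 * wordDen τ 0 ^ 2 = (2 * wordDen τ 0) ^ 2 := by ring
  rw [h2]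
  gcongr

theorem IsConformal.measure_closedBall_wordMap_le {E : Set ℕ} (hE : 0 ∉ E) {δ : ℝ} (hδ : 0 ≤ δ)
    {μ : Measure ℝ} (hμ : IsConformal E δ μ) {σ : List ℕ} {c b : ℕ}
    (hτ : ∀ a ∈ σ ++ [c, b], 1 ≤ a) {y s : ℝ} (hy : 0 ≤ y) (hy' : y ≤ 2 / 3) (hs : s ≤ 1 / 16)
    {T : Set ℝ} (hT : ∀ u ∈ Ioo (0 : ℝ) 1, |u - y| ≤ 8 * s → u ∈ T) :
    μ (closedBall (wordMap (σ ++ [c, b]) y) (s / wordDen (σ ++ [c, b]) 0 ^ 2)) ≤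
      2 * (ENNReal.ofReal ((1 / wordDen (σ ++ [c, b]) 0 ^ 2) ^ δ) * μ T) := by
  obtain ⟨τ', hτ', hQ, hN⟩ := exists_neighbor hτ
  set τ := σ ++ [c, b]
  set B := closedBall (wordMap τ y) (s / wordDen τ 0 ^ 2) with hBdef
  have hQ0 := one_le_wordDen_zero hτ
  have hpull {u : ℝ} (hu : u ∈ Icc (-1 / 2 : ℝ) 1) (huB : wordMap τ u ∈ B) : |u - y| ≤ 4 * s := by
    have h := (le_abs_wordMap_sub hτ hu (y := y) ⟨by linarith, by linarith⟩).trans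
      (by simpa [hBdef, Real.dist_eq] using huB)
    rw [div_le_div_iff₀ (by positivity) (by positivity)] at h
    have hQ2 : 0 < wordDen τ 0 ^ 2 := by positivity
    nlinarith
  have hcover : B ∩ limitSet E ⊆
      (B ∩ wordMap τ '' Ioo 0 1) ∪ (B ∩ wordMap τ' '' Ioo 0 1) := by
    rintro z ⟨hzB, hz⟩
    obtain ⟨v, hv, rfl, hvy⟩ := exists_wordMap_eq_of_abs_sub_le hτ hy hy' hs
      (by simpa [hBdef, Real.dist_eq] using hzB)
    have hvy' := abs_le.1 hvy
    rcases lt_trichotomy v 0 with h | h | h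
    · have hv1 : 0 < 1 + v := by linarith [hv.1]
      have ht : -v / (1 + v) ∈ Ioo (0 : ℝ) 1 :=
        ⟨div_pos (by linarith) hv1, by rw [div_lt_one hv1]; linarith⟩
      refine Or.inr ⟨hzB, -v / (1 + v), ht, ?_⟩
      rw [hN _ (Ioo_subset_Icc_self ht)]
      congr 1
      field_simp
      ring
    · exact absurd (h ▸ hz) (wordMap_zero_notMem_limitSet hE hτ)
    · exact Or.inl ⟨hzB, v, ⟨h, by linarith⟩, rfl⟩
  have h1 : wordMap τ ⁻¹' B ∩ Ioo 0 1 ⊆ T := by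
    rintro u ⟨huB, hu⟩
    have h := hpull ⟨by linarith [hu.1], hu.2.le⟩ huB
    exact hT u hu (by linarith [abs_nonneg (u - y)])
  have h2 : wordMap τ' ⁻¹' B ∩ Ioo 0 1 ⊆ T := by
    rintro u ⟨huB, hu⟩
    have hu1 : 0 < 1 + u := by linarith [hu.1]
    rw [mem_preimage, hN u (Ioo_subset_Icc_self hu)] at huB
    have e : -u / (1 + u) ≤ -u / 2 := by
      rw [div_le_div_iff₀ hu1 two_pos]
      nlinarith [hu.1, hu.2]
    have e' : -1 / 2 ≤ -u / (1 + u) := by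
      rw [div_le_div_iff₀ two_pos hu1]
      nlinarith [hu.1, hu.2]
    have h := abs_le.1 (hpull ⟨e', by linarith [hu.1]⟩ huB)
    refine hT u hu (abs_le.2 ⟨?_, ?_⟩) <;> linarith [hu.1]
  calc μ B ≤ μ (B ∩ limitSet E) + μ (limitSet E)ᶜ :=
        (measure_mono fun z hz => by
          by_cases h : z ∈ limitSet E
          exacts [Or.inl ⟨hz, h⟩, Or.inr h]).trans (measure_union_le _ _)
    _ = μ (B ∩ limitSet E) := by rw [hμ.2.1, add_zero]
    _ ≤ μ (B ∩ wordMap τ '' Ioo 0 1) + μ (B ∩ wordMap τ' '' Ioo 0 1) :=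
        (measure_mono hcover).trans (measure_union_le _ _)
    _ ≤ ENNReal.ofReal ((1 / wordDen τ 0 ^ 2) ^ δ) * μ T +
          ENNReal.ofReal ((1 / wordDen τ 0 ^ 2) ^ δ) * μ T := by
        refine add_le_add
          ((hμ.measure_inter_image_le hE hδ hτ measurableSet_closedBall).trans
            (mul_le_mul_right (measure_mono h1) _)) ?_
        have h := hμ.measure_inter_image_le hE hδ hτ' (S := B) measurableSet_closedBall
        rw [hQ] at h
        exact h.trans (mul_le_mul_right (measure_mono h2) _)
    _ = _ := (two_mul _).symm

theorem prefixWord_add_two (ω : ℕ → ℕ) (n : ℕ) :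
    prefixWord ω (n + 2) = prefixWord ω n ++ [ω n, ω (n + 1)] := by
  rw [prefixWord_succ, prefixWord_succ]; simp

/-- Balls around a limit point are controlled from above by thickenings of first-level
cylinders. -/
theorem IsConformal.measure_closedBall_le {E : Set ℕ} (hE : 0 ∉ E) {δ : ℝ} (hδ : 0 ≤ δ)
    {μ : Measure ℝ} (hμ : IsConformal E δ μ) {ω : ℕ → ℕ} (hω : ∀ n, ω n ∈ E) {n : ℕ}
    (hn : 2 ≤ n) {r : ℝ} (hr : 1 / (ω n : ℝ) ^ 2 ≤ r) (hr1 : r ≤ 1) :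
    μ (closedBall (codingMap ω) (r / (64 * wordDen (prefixWord ω n) 0 ^ 2))) ≤
      2 * (ENNReal.ofReal ((1 / wordDen (prefixWord ω n) 0 ^ 2) ^ δ) *
        μ (cthickening r (cyl [ω n]))) := by
  have hω1 (n : ℕ) : 1 ≤ ω n := Nat.one_le_iff_ne_zero.2 fun h => hE (h ▸ hω n)
  obtain ⟨m, rfl⟩ := Nat.exists_eq_add_of_le' hn
  have hr0 : 0 ≤ r := le_trans (by positivity) hr
  have hy := codingMap_mem_Ioo fun i => hω1 (m + 2 + i)
  have hycyl := (codingMap_shift_mem hω1 (m + 2)).1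
  have hx := codingMap_eq_wordMap hω1 (m + 2)
  have hyn := codingMap_shift hω1 (m + 2)
  have hτ := forall_mem_prefixWord hω1 (m + 2)
  by_cases hy23 : (codingMap fun i => ω (m + 2 + i)) ≤ 2 / 3
  · rw [hx]
    have e : r / (64 * wordDen (prefixWord ω (m + 2)) 0 ^ 2)
        = (r / 64) / wordDen (prefixWord ω (m + 2)) 0 ^ 2 := by rw [div_div]
    rw [e]
    rw [prefixWord_add_two] at hτ ⊢
    refine hμ.measure_closedBall_wordMap_le hE hδ hτ hy.1.le hy23 (by linarith)
      fun u _ huy => mem_cthickening_of_dist_le u _ r _ hycyl ?_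
    rw [Real.dist_eq]
    linarith
  · have hz := codingMap_mem_Ioo fun i => hω1 (m + 2 + 1 + i)
    set z := codingMap fun i => ω (m + 2 + 1 + i) with hzdef
    have ha1 : (1 : ℝ) ≤ ω (m + 2) := by exact_mod_cast hω1 (m + 2)
    rw [hyn, gaussMap, not_le, lt_div_iff₀ (by linarith [hz.1])] at hy23
    have ha : ω (m + 2) = 1 := by
      have : (ω (m + 2) : ℝ) < 2 := by linarith [hz.1]
      have : ω (m + 2) < 2 := by exact_mod_cast this
      have := hω1 (m + 2)
      omega
    have hz23 : z ≤ 2 / 3 := by linarith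
    have hr' : r = 1 := le_antisymm hr1 (by simpa [ha] using hr)
    have hQ := wordDen_concat hτ (hω1 (m + 2))
    rw [← prefixWord_succ, ha, Nat.cast_one, one_mul] at hQ
    have hx' := codingMap_eq_wordMap hω1 (m + 2 + 1)
    have hτ' := forall_mem_prefixWord hω1 (m + 2 + 1)
    have hQ0 := one_le_wordDen_zero hτ
    have hQ0' := one_le_wordDen_zero hτ'
    have hball : closedBall (codingMap ω) (r / (64 * wordDen (prefixWord ω (m + 2)) 0 ^ 2)) ⊆
        closedBall (codingMap ω) ((1 / 16) / wordDen (prefixWord ω (m + 2 + 1)) 0 ^ 2) := by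
      refine closedBall_subset_closedBall ?_
      rw [hr', div_le_div_iff₀ (by positivity) (by positivity)]
      nlinarith [hQ.2]
    have hT : ∀ u ∈ Ioo (0 : ℝ) 1, |u - z| ≤ 8 * (1 / 16) →
        u ∈ cthickening r (cyl [ω (m + 2)]) := by
      intro u hu _
      refine mem_cthickening_of_dist_le u _ r _ hycyl ?_
      rw [Real.dist_eq, hr']
      exact abs_le.2 ⟨by linarith [hu.1, hy.2], by linarith [hu.2, hy.1]⟩
    refine (measure_mono hball).trans ?_
    rw [hx']
    have e : prefixWord ω (m + 2 + 1) = prefixWord ω (m + 1) ++ [ω (m + 1), ω (m + 2)] :=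
      prefixWord_add_two ω (m + 1)
    rw [e] at hτ' hQ hQ0' ⊢
    refine (hμ.measure_closedBall_wordMap_le hE hδ hτ' hz.1.le hz23 le_rfl hT).trans ?_
    have := hQ.1
    gcongr

/-- Balls around a limit point are controlled from below by thickenings of first-level
cylinders. -/
theorem IsConformal.le_measure_closedBall {E : Set ℕ} (hE : 0 ∉ E) {δ : ℝ} (hδ : 0 ≤ δ)
    {μ : Measure ℝ} (hμ : IsConformal E δ μ) {ω : ℕ → ℕ} (hω : ∀ n, ω n ∈ E) {n : ℕ}
    {r : ℝ} (hr : 1 / (ω n : ℝ) ^ 2 ≤ r) :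
    ENNReal.ofReal ((1 / (4 * wordDen (prefixWord ω n) 0 ^ 2)) ^ δ) *
        μ (cthickening r (cyl [ω n])) ≤
      μ (closedBall (codingMap ω) (2 * r / wordDen (prefixWord ω n) 0 ^ 2)) := by
  have hω1 (n : ℕ) : 1 ≤ ω n := Nat.one_le_iff_ne_zero.2 fun h => hE (h ▸ hω n)
  have hr0 : 0 ≤ r := le_trans (by positivity) hr
  have hτ := forall_mem_prefixWord hω1 n
  have hy := codingMap_mem_Ioo fun i => hω1 (n + i)
  have hcyl := (codingMap_shift_mem hω1 n).2
  have hx := codingMap_eq_wordMap hω1 n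
  have hcompact : IsCompact (cyl [ω n]) :=
    isCompact_Icc.image_of_continuousOn ((continuousOn_wordMap (ω := [ω n])
      (by simpa using hω1 n)).mono fun u hu => by simp only [mem_Ioi]; linarith [hu.1])
  have hsub : cthickening r (cyl [ω n]) ∩ Ioo 0 1 ⊆ wordMap (prefixWord ω n) ⁻¹'
      closedBall (codingMap ω) (2 * r / wordDen (prefixWord ω n) 0 ^ 2) ∩ Ioo 0 1 := by
    rintro u ⟨hu, huI⟩
    refine ⟨?_, huI⟩
    rw [hcompact.cthickening_eq_biUnion_closedBall hr0] at hu
    obtain ⟨w, hw, huw⟩ := mem_iUnion₂.1 hu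
    rw [mem_closedBall, Real.dist_eq] at huw
    have h := (abs_sub_le _ _ _).trans (add_le_add huw (hcyl w hw))
    rw [mem_preimage, mem_closedBall, Real.dist_eq, hx]
    refine (abs_wordMap_sub_le hτ (Ioo_subset_Icc_self huI) (Ioo_subset_Icc_self hy)).trans ?_
    gcongr
    linarith
  calc _ ≤ _ * μ (cthickening r (cyl [ω n]) ∩ Ioo 0 1) := by
        have h0 : μ (Ioo (0 : ℝ) 1)ᶜ = 0 := hμ.ae_mem_Ioo hE
        rw [measure_inter_conull h0]
    _ ≤ _ := mul_le_mul_right (measure_mono hsub) _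
    _ ≤ _ := hμ.le_measure_inter_image hE hδ (forall_mem_prefixWord hω n) measurableSet_closedBall
    _ ≤ _ := measure_mono inter_subset_left

theorem mem_W_prefixWord_iff {ω : ℕ → ℕ} (hω : ∀ n, 1 ≤ ω n) {lam : ℝ} (hlam : 1 < lam)
    {n k : ℕ} :
    prefixWord ω n ∈ W lam k ↔ lam ^ k ≤ wordDen (prefixWord ω n) 0 ^ 2 ∧
      wordDen (prefixWord ω n) 0 ^ 2 < lam ^ (k + 1) := by
  have hQ := one_le_wordDen_zero (forall_mem_prefixWord hω n)
  have h0 : 0 < lam := by linarith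
  have e1 : lam ^ (-(k : ℝ)) = (lam ^ k)⁻¹ := by rw [Real.rpow_neg h0.le, Real.rpow_natCast]
  have e2 : lam ^ (-(k : ℝ) - 1) = (lam ^ (k + 1))⁻¹ := by
    rw [← neg_add', Real.rpow_neg h0.le, ← Nat.cast_add_one, Real.rpow_natCast]
  rw [W, mem_ofPred_eq, derivNorm_eq (forall_mem_prefixWord hω n), e1, e2, one_div,
    inv_lt_inv₀ (by positivity) (by positivity), inv_le_inv₀ (by positivity) (by positivity),
    and_comm]

theorem exists_mem_W_prefixWord {ω : ℕ → ℕ} (hω : ∀ n, 1 ≤ ω n) {lam : ℝ} (hlam : 1 < lam)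
    (n : ℕ) : ∃ k, prefixWord ω n ∈ W lam k := by
  have hQ := one_le_wordDen_zero (forall_mem_prefixWord hω n)
  obtain ⟨k, hk⟩ := exists_nat_pow_near (one_le_pow₀ hQ (n := 2)) hlam
  exact ⟨k, (mem_W_prefixWord_iff hω hlam).2 hk⟩

theorem eq_of_mem_W_prefixWord {ω : ℕ → ℕ} (hω : ∀ n, 1 ≤ ω n) {lam : ℝ} (hlam : 1 < lam)
    {n k l : ℕ} (hk : prefixWord ω n ∈ W lam k) (hl : prefixWord ω n ∈ W lam l) : k = l := by
  rw [mem_W_prefixWord_iff hω hlam] at hk hl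
  have h1 := (pow_lt_pow_iff_right₀ hlam).1 (hk.1.trans_lt hl.2)
  have h2 := (pow_lt_pow_iff_right₀ hlam).1 (hl.1.trans_lt hk.2)
  omega

/-- The scale `λ^{-k}` of an initial word in `W_k` is comparable to the size of its cylinder. -/
theorem scale_mem_Icc_of_mem_W {ω : ℕ → ℕ} (hω : ∀ n, 1 ≤ ω n) {lam : ℝ} (hlam : 1 < lam)
    {n k : ℕ} (hk : prefixWord ω n ∈ W lam k) :
    lam ^ (-(k : ℝ)) ∈ Icc (1 / wordDen (prefixWord ω n) 0 ^ 2)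
      (lam * (1 / wordDen (prefixWord ω n) 0 ^ 2)) := by
  have h0 : 0 < lam := by linarith
  rw [W, mem_ofPred_eq, derivNorm_eq (forall_mem_prefixWord hω n), Real.rpow_sub_one h0.ne',
    div_lt_iff₀ h0, mul_comm] at hk
  exact ⟨hk.2, hk.1.le⟩

theorem infinite_mem_W_iff {ω : ℕ → ℕ} (hω : ∀ n, 1 ≤ ω n) {lam : ℝ} (hlam : 1 < lam)
    (p : ℕ → ℕ → Prop) :
    {q : ℕ × ℕ | prefixWord ω q.1 ∈ W lam q.2 ∧ p q.1 q.2}.Infinite ↔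
      ∀ N, ∃ n ≥ N, ∃ k, prefixWord ω n ∈ W lam k ∧ p n k := by
  have hinj : InjOn Prod.fst {q : ℕ × ℕ | prefixWord ω q.1 ∈ W lam q.2 ∧ p q.1 q.2} := by
    rintro ⟨n, k⟩ hk ⟨m, l⟩ hl (rfl : n = m)
    exact Prod.ext rfl (eq_of_mem_W_prefixWord hω hlam hk.1 hl.1)
  have himg : Prod.fst '' {q : ℕ × ℕ | prefixWord ω q.1 ∈ W lam q.2 ∧ p q.1 q.2} =
      {n | ∃ k, prefixWord ω n ∈ W lam k ∧ p n k} := by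
    ext n
    simp
  rw [← infinite_image_iff hinj, himg, ← Nat.frequently_atTop_iff_infinite, frequently_atTop]

/-- `ψ` at scale `ρ` is comparable, up to the factor `K`, to the gauge `r^δ Ψ(L r)` at scale `r`
inside a cylinder of size `P`, whenever `L ≍ P` and `ρ ≍ P r`. -/
def ScaleComparable (δ lam K : ℝ) (ψ Ψ : ℝ → ℝ) : Prop :=
  ∀ P L r ρ : ℝ, 0 < P → L ∈ Icc P (lam * P) → 0 < r → ρ ≤ 8 * (r * P) → r * P ≤ 256 * ρ →
    ψ ρ ≤ K * ((P / 4) ^ δ * (r ^ δ * Ψ (L * r))) ∧ 2 * P ^ δ * (r ^ δ * Ψ (L * r)) ≤ K * ψ ρ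

theorem IsDoubling.exists_scaleComparable {ψ Ψ : ℝ → ℝ} (hdbl : IsDoubling ψ)
    (hψ : ∀ r : ℝ, 0 < r → 0 < ψ r) {δ lam : ℝ} (hδ : 0 ≤ δ) (hlam : 1 < lam)
    (hΨ : Ψ = fun r : ℝ => r ^ (-δ) * ψ r) :
    ∃ K : ℝ, 0 < K ∧ ScaleComparable δ lam K ψ Ψ := by
  obtain ⟨D, hD, h⟩ := hdbl (256 * lam) (by linarith)
  have hl : 1 ≤ (4 * lam) ^ δ := Real.one_le_rpow (by linarith) hδ
  refine ⟨2 * (4 * lam) ^ δ * D, by positivity, fun P L r ρ hP hL hr h8 h256 => ?_⟩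
  have hL0 : 0 < L := hP.trans_le hL.1
  have hrP : 0 < r * P := by positivity
  have hρ : 0 < ρ := by linarith
  have hLr : 0 < L * r := by positivity
  obtain ⟨hl1, hl2⟩ := h (L * r) ρ hLr hρ
    (by
      rw [le_div_iff₀ hρ, inv_mul_le_iff₀ (by positivity)]
      nlinarith [mul_le_mul_of_nonneg_right hL.1 hr.le, mul_pos hLr (sub_pos.2 hlam)])
    (by
      rw [div_le_iff₀ hρ]
      nlinarith [mul_le_mul_of_nonneg_right hL.2 hr.le])
  have hψρ := hψ ρ hρ
  have hψL := hψ _ hLr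
  rw [le_div_iff₀ hψρ, inv_mul_le_iff₀ (by positivity)] at hl1
  rw [div_le_iff₀ hψρ] at hl2
  have e : r ^ δ * Ψ (L * r) = L ^ (-δ) * ψ (L * r) := by
    rw [hΨ]
    simp only
    rw [Real.mul_rpow hL0.le hr.le, Real.rpow_neg hr.le]
    field_simp
  have hd1 : P ^ δ ≤ L ^ δ := Real.rpow_le_rpow hP.le hL.1 hδ
  have hd2 : L ^ δ ≤ (4 * lam) ^ δ * (P / 4) ^ δ := by
    rw [← Real.mul_rpow (by positivity) (by positivity)]
    exact Real.rpow_le_rpow hL0.le (hL.2.trans_eq (by ring)) hδ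
  have hLδ : 0 < L ^ δ := by positivity
  rw [e, Real.rpow_neg hL0.le]
  constructor
  · have h1 : 1 ≤ (4 * lam) ^ δ * (P / 4) ^ δ * (L ^ δ)⁻¹ := by
      rw [← div_eq_mul_inv, one_le_div hLδ]
      exact hd2
    calc ψ ρ ≤ 1 * (D * ψ (L * r)) := by linarith
      _ ≤ (2 * ((4 * lam) ^ δ * (P / 4) ^ δ * (L ^ δ)⁻¹)) * (D * ψ (L * r)) := by
        gcongr
        linarith
      _ = _ := by ring
  · have h1 : P ^ δ * (L ^ δ)⁻¹ ≤ (4 * lam) ^ δ := by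
      refine le_trans ?_ hl
      rw [← div_eq_mul_inv, div_le_one hLδ]
      exact hd1
    calc _ = 2 * (P ^ δ * (L ^ δ)⁻¹) * ψ (L * r) := by ring
      _ ≤ 2 * (4 * lam) ^ δ * (D * ψ ρ) := by gcongr
      _ = _ := by ring

theorem exists_radius_lt {ω : ℕ → ℕ} (hω : ∀ n, 1 ≤ ω n) {ε : ℝ} (hε : 0 < ε) :
    ∃ N, ∀ n ≥ N, 1 / wordDen (prefixWord ω n) 0 ^ 2 < ε :=
  eventually_atTop.1 ((tendsto_one_div_wordDen_sq hω).eventually (gt_mem_nhds hε))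

section Density

variable {E : Set ℕ} {δ lam K : ℝ} {μ : Measure ℝ} {ψ Ψ : ℝ → ℝ} {ω : ℕ → ℕ}

theorem IsConformal.le_upperDensity_of_mem_SsetH (hE : 0 ∉ E) (hδ : 0 ≤ δ)
    (hμ : IsConformal E δ μ) (hlam : 1 < lam) (hψ : ∀ r : ℝ, 0 < r → 0 < ψ r) (hK : 0 < K)
    (hcmp : ScaleComparable δ lam K ψ Ψ) (hω : ∀ n, ω n ∈ E) {α : ℝ} (hα : 0 < α)
    (hS : ω ∈ SsetH E δ μ Ψ lam α) :
    ENNReal.ofReal (α / K) ≤ upperDensity ψ μ (codingMap ω) := by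
  have hω1 (n : ℕ) : 1 ≤ ω n := Nat.one_le_iff_ne_zero.2 fun h => hE (h ▸ hω n)
  have hS' := (infinite_mem_W_iff hω1 hlam fun n k => ω n ∈ JsetH E δ μ Ψ lam k α).1 hS
  refine le_limsup_of_frequently_le' ((nhdsGT_basis (0 : ℝ)).frequently_iff.2 fun ε hε => ?_)
  obtain ⟨N, hN⟩ := exists_radius_lt hω1 (half_pos hε)
  obtain ⟨n, hn, k, hk, -, r, hr, hr1, hm⟩ := hS' N
  have hP := hN n hn
  have hQ := one_le_wordDen_zero (forall_mem_prefixWord hω1 n)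
  have hL := scale_mem_Icc_of_mem_W hω1 hlam hk
  have hball := hμ.le_measure_closedBall hE hδ hω (n := n) (r := r)
  rw [derivNorm_singleton (hω1 n)] at hr
  have hr0 : 0 < r := lt_of_lt_of_le (by have := hω1 n; positivity) hr
  have hball := hball hr
  generalize wordDen (prefixWord ω n) 0 = Q at *
  have hP0 : 0 < 1 / Q ^ 2 := by positivity
  have hρ : 0 < 2 * r / Q ^ 2 := by positivity
  have hρε : 2 * r / Q ^ 2 < ε := by
    rw [mul_div_assoc, div_eq_mul_one_div r]
    nlinarith
  have e : 1 / (4 * Q ^ 2) = 1 / Q ^ 2 / 4 := by ring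
  have e' : 2 * r / Q ^ 2 = 2 * (r * (1 / Q ^ 2)) := by ring
  obtain ⟨hc, -⟩ := hcmp (1 / Q ^ 2) _ r (2 * r / Q ^ 2) hP0 hL hr0
    (by rw [e']; have := mul_pos hr0 hP0; linarith)
    (by rw [e']; have := mul_pos hr0 hP0; linarith)
  refine ⟨_, ⟨hρ, hρε⟩, ?_⟩
  rw [ENNReal.le_div_iff_mul_le (.inl (ENNReal.ofReal_pos.2 (hψ _ hρ)).ne')
    (.inl ENNReal.ofReal_ne_top), ← ENNReal.ofReal_mul (by positivity)]
  refine le_trans ?_ ((mul_le_mul_right hm _).trans hball)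
  rw [e, ← ENNReal.ofReal_mul (by positivity)]
  refine ENNReal.ofReal_le_ofReal ?_
  rw [div_mul_eq_mul_div, div_le_iff₀ hK]
  exact (mul_le_mul_of_nonneg_left hc hα.le).trans_eq (by ring)

theorem IsConformal.mem_SsetH_of_lt_upperDensity (hE : 0 ∉ E) (hδ : 0 ≤ δ)
    (hμ : IsConformal E δ μ) (hlam : 1 < lam) (hψ : ∀ r : ℝ, 0 < r → 0 < ψ r) (hK : 0 < K)
    (hcmp : ScaleComparable δ lam K ψ Ψ) (hω : ∀ n, ω n ∈ E) {β : ℝ} (hβ : 0 < β)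
    (h : ENNReal.ofReal β < upperDensity ψ μ (codingMap ω)) :
    ω ∈ SsetH E δ μ Ψ lam (β / K) := by
  have hω1 (n : ℕ) : 1 ≤ ω n := Nat.one_le_iff_ne_zero.2 fun h => hE (h ▸ hω n)
  refine (infinite_mem_W_iff hω1 hlam
    fun n k => ω n ∈ JsetH E δ μ Ψ lam k (β / K)).2 fun N => ?_
  have hQ := one_le_wordDen_zero (forall_mem_prefixWord hω1 (max N 2))
  obtain ⟨ρ, ⟨hρ0, hρ⟩, hlt⟩ := (nhdsGT_basis (0 : ℝ)).frequently_iff.1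
    (frequently_lt_of_lt_limsup (by isBoundedDefault) h)
    (1 / wordDen (prefixWord ω (max N 2)) 0 ^ 2 / 64) (by positivity)
  obtain ⟨n, hn, r, hr, hr1, hl, hu⟩ := exists_scale hω1 (max N 2) (ρ := 64 * ρ)
    (by positivity) (by linarith)
  obtain ⟨k, hk⟩ := exists_mem_W_prefixWord hω1 hlam n
  refine ⟨n, le_of_max_le_left hn, k, hk, hω n, r, ?_, hr1, ?_⟩
  · rwa [derivNorm_singleton (hω1 n)]
  have hQ := one_le_wordDen_zero (forall_mem_prefixWord hω1 n)
  have hL := scale_mem_Icc_of_mem_W hω1 hlam hk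
  have hball := hμ.measure_closedBall_le hE hδ hω (le_of_max_le_right hn) hr hr1
  have hr0 : 0 < r := lt_of_lt_of_le (by have := hω1 n; positivity) hr
  generalize wordDen (prefixWord ω n) 0 = Q at *
  have hP0 : 0 < 1 / Q ^ 2 := by positivity
  have e : r / Q ^ 2 = r * (1 / Q ^ 2) := by ring
  obtain ⟨-, hc⟩ := hcmp (1 / Q ^ 2) _ r ρ hP0 hL hr0 (by linarith) (by linarith)
  have hsub : closedBall (codingMap ω) ρ ⊆ closedBall (codingMap ω) (r / (64 * Q ^ 2)) := by
    refine closedBall_subset_closedBall ?_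
    rw [mul_comm, ← div_div, le_div_iff₀ (by norm_num)]
    linarith
  rw [ENNReal.lt_div_iff_mul_lt (.inl (ENNReal.ofReal_pos.2 (hψ _ hρ0)).ne')
    (.inl ENNReal.ofReal_ne_top), ← ENNReal.ofReal_mul hβ.le] at hlt
  have hchain := hlt.le.trans ((measure_mono hsub).trans hball)
  have hpow : 0 < (1 / Q ^ 2) ^ δ := by positivity
  rw [← mul_assoc, ← ENNReal.ofReal_ofNat 2, ← ENNReal.ofReal_mul (by norm_num)] at hchain
  refine (ENNReal.mul_le_mul_iff_right (a := ENNReal.ofReal (2 * (1 / Q ^ 2) ^ δ))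
    (ENNReal.ofReal_pos.2 (by positivity)).ne' ENNReal.ofReal_ne_top).1 (le_trans ?_ hchain)
  rw [← ENNReal.ofReal_mul (by positivity)]
  refine ENNReal.ofReal_le_ofReal ?_
  calc _ = 2 * (1 / Q ^ 2) ^ δ * (r ^ δ * Ψ (lam ^ (-(k : ℝ)) * r)) * (β / K) := by ring
    _ ≤ K * ψ ρ * (β / K) := by gcongr
    _ = _ := by field_simp

theorem IsConformal.lowerDensity_le_of_mem_SsetP (hE : 0 ∉ E) (hδ : 0 ≤ δ)
    (hμ : IsConformal E δ μ) (hlam : 1 < lam) (hK : 0 < K)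
    (hcmp : ScaleComparable δ lam K ψ Ψ) (hω : ∀ n, ω n ∈ E) {α : ℝ} (hα : 0 < α)
    (hS : ω ∈ SsetP E δ μ Ψ lam α) :
    lowerDensity ψ μ (codingMap ω) ≤ ENNReal.ofReal (K * α) := by
  have hω1 (n : ℕ) : 1 ≤ ω n := Nat.one_le_iff_ne_zero.2 fun h => hE (h ▸ hω n)
  have hS' := (infinite_mem_W_iff hω1 hlam fun n k => ω n ∈ JsetP E δ μ Ψ lam k α).1 hS
  refine liminf_le_of_frequently_le' ((nhdsGT_basis (0 : ℝ)).frequently_iff.2 fun ε hε => ?_)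
  obtain ⟨N, hN⟩ := exists_radius_lt hω1 hε
  obtain ⟨n, hn, k, hk, -, r, hr, hr1, hm⟩ := hS' (max N 2)
  have hP := hN n (le_of_max_le_left hn)
  have hQ := one_le_wordDen_zero (forall_mem_prefixWord hω1 n)
  have hL := scale_mem_Icc_of_mem_W hω1 hlam hk
  rw [derivNorm_singleton (hω1 n)] at hr
  have hr0 : 0 < r := lt_of_lt_of_le (by have := hω1 n; positivity) hr
  have hball := hμ.measure_closedBall_le hE hδ hω (le_of_max_le_right hn) hr hr1
  generalize wordDen (prefixWord ω n) 0 = Q at *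
  have hP0 : 0 < 1 / Q ^ 2 := by positivity
  have hρ : 0 < r / (64 * Q ^ 2) := by positivity
  have e' : r / (64 * Q ^ 2) = r * (1 / Q ^ 2) / 64 := by ring
  have hrP := mul_pos hr0 hP0
  have hρε : r / (64 * Q ^ 2) < ε := by
    rw [e']
    nlinarith
  obtain ⟨-, hc⟩ := hcmp (1 / Q ^ 2) _ r (r / (64 * Q ^ 2)) hP0 hL hr0
    (by rw [e']; linarith) (by rw [e']; linarith)
  refine ⟨_, ⟨hρ, hρε⟩, ?_⟩
  refine ENNReal.div_le_of_le_mul ?_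
  rw [← ENNReal.ofReal_mul (by positivity)]
  refine hball.trans ?_
  rw [← mul_assoc, ← ENNReal.ofReal_ofNat 2, ← ENNReal.ofReal_mul (by norm_num)]
  refine (mul_le_mul_right hm _).trans ?_
  rw [← ENNReal.ofReal_mul (by positivity)]
  refine ENNReal.ofReal_le_ofReal ?_
  calc _ = 2 * (1 / Q ^ 2) ^ δ * (r ^ δ * Ψ (lam ^ (-(k : ℝ)) * r)) * α := by ring
    _ ≤ K * ψ (r / (64 * Q ^ 2)) * α := by gcongr
    _ = _ := by ring

theorem IsConformal.mem_SsetP_of_lowerDensity_lt (hE : 0 ∉ E) (hδ : 0 ≤ δ)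
    (hμ : IsConformal E δ μ) (hlam : 1 < lam) (hψ : ∀ r : ℝ, 0 < r → 0 < ψ r)
    (hcmp : ScaleComparable δ lam K ψ Ψ) (hω : ∀ n, ω n ∈ E) {β : ℝ} (hβ : 0 < β)
    (h : lowerDensity ψ μ (codingMap ω) < ENNReal.ofReal β) :
    ω ∈ SsetP E δ μ Ψ lam (K * β) := by
  have hω1 (n : ℕ) : 1 ≤ ω n := Nat.one_le_iff_ne_zero.2 fun h => hE (h ▸ hω n)
  refine (infinite_mem_W_iff hω1 hlam
    fun n k => ω n ∈ JsetP E δ μ Ψ lam k (K * β)).2 fun N => ?_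
  have hQ := one_le_wordDen_zero (forall_mem_prefixWord hω1 N)
  obtain ⟨ρ, ⟨hρ0, hρ⟩, hlt⟩ := (nhdsGT_basis (0 : ℝ)).frequently_iff.1
    (frequently_lt_of_liminf_lt (by isBoundedDefault) h)
    (1 / wordDen (prefixWord ω N) 0 ^ 2) (by positivity)
  obtain ⟨n, hn, r, hr, hr1, hl, hu⟩ := exists_scale hω1 N (ρ := ρ / 8)
    (by positivity) (by linarith)
  obtain ⟨k, hk⟩ := exists_mem_W_prefixWord hω1 hlam n
  refine ⟨n, hn, k, hk, hω n, r, ?_, hr1, ?_⟩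
  · rwa [derivNorm_singleton (hω1 n)]
  have hQ := one_le_wordDen_zero (forall_mem_prefixWord hω1 n)
  have hL := scale_mem_Icc_of_mem_W hω1 hlam hk
  have hball := hμ.le_measure_closedBall hE hδ hω hr
  have hr0 : 0 < r := lt_of_lt_of_le (by have := hω1 n; positivity) hr
  generalize wordDen (prefixWord ω n) 0 = Q at *
  have hP0 : 0 < 1 / Q ^ 2 := by positivity
  have e : r / Q ^ 2 = r * (1 / Q ^ 2) := by ring
  have e' : 1 / (4 * Q ^ 2) = 1 / Q ^ 2 / 4 := by ring
  obtain ⟨hc, -⟩ := hcmp (1 / Q ^ 2) _ r ρ hP0 hL hr0 (by linarith) (by linarith)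
  have hsub : closedBall (codingMap ω) (2 * r / Q ^ 2) ⊆ closedBall (codingMap ω) ρ := by
    refine closedBall_subset_closedBall ?_
    rw [mul_div_assoc]
    linarith
  rw [ENNReal.div_lt_iff (.inl (ENNReal.ofReal_pos.2 (hψ _ hρ0)).ne')
    (.inl ENNReal.ofReal_ne_top), ← ENNReal.ofReal_mul hβ.le] at hlt
  have hchain := (hball.trans (measure_mono hsub)).trans hlt.le
  rw [e'] at hchain
  refine (ENNReal.mul_le_mul_iff_right (a := ENNReal.ofReal ((1 / Q ^ 2 / 4) ^ δ))
    (ENNReal.ofReal_pos.2 (by positivity)).ne' ENNReal.ofReal_ne_top).1 (hchain.trans ?_)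
  rw [← ENNReal.ofReal_mul (by positivity)]
  refine ENNReal.ofReal_le_ofReal ?_
  exact (mul_le_mul_of_nonneg_left hc hβ.le).trans_eq (by ring)

end Density

/-- Proposition on densities. For a regular Gauss IFS satisfying
Assumptions 1, C, 3, and a doubling dimension function `ψ` with `Ψ(r) = r^{-δ} ψ(r)`:
`sup{α > 0 : ω ∈ S_{α,1}} ≍ D̄^ψ_μ(π(ω))` (for `Ψ` decreasing) and
`inf{α > 0 : ω ∈ S_{α,-1}} ≍ D̲^ψ_μ(π(ω))` (for `Ψ` increasing), with implied constants
independent of `ω`. -/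
theorem stmt11 (E : Set ℕ) (hE : 0 ∉ E) (δ : ℝ) (hδ : 0 ≤ δ) (hpress : pressure E δ = 0)
    (μ : Measure ℝ) (hμ : IsConformal E δ μ)
    (f : ℝ → ℝ) (s : ℝ) (hs : δ < s ∧ s < 2 * δ) (hreg : RegVarying f s)
    (h1 : Assumption1 E f)
    (lam : ℝ) (hlam : 1 < lam) (hC : AssumptionC E μ lam)
    (h3 : Assumption3 E μ)
    (ψ : ℝ → ℝ) (hdim : IsDimFun ψ) (hdbl : IsDoubling ψ)
    (Ψ : ℝ → ℝ) (hΨ : Ψ = fun r : ℝ => r ^ (-δ) * ψ r) :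
    ∃ c C : ℝ≥0∞, 0 < c ∧ C ≠ ⊤ ∧ ∀ ω : ℕ → ℕ, (∀ n, ω n ∈ E) →
      (AntitoneOn Ψ (Ioi 0) →
        c * upperDensity ψ μ (codingMap ω) ≤
            (⨆ (α : ℝ) (_ : 0 < α) (_ : ω ∈ SsetH E δ μ Ψ lam α), ENNReal.ofReal α) ∧
          (⨆ (α : ℝ) (_ : 0 < α) (_ : ω ∈ SsetH E δ μ Ψ lam α), ENNReal.ofReal α) ≤
            C * upperDensity ψ μ (codingMap ω)) ∧
      (MonotoneOn Ψ (Ioi 0) →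
        c * lowerDensity ψ μ (codingMap ω) ≤
            (⨅ (α : ℝ) (_ : 0 < α) (_ : ω ∈ SsetP E δ μ Ψ lam α), ENNReal.ofReal α) ∧
          (⨅ (α : ℝ) (_ : 0 < α) (_ : ω ∈ SsetP E δ μ Ψ lam α), ENNReal.ofReal α) ≤
            C * lowerDensity ψ μ (codingMap ω)) := by
  have hψ := hdim.2.2.1
  obtain ⟨K, hK, hcmp⟩ := hdbl.exists_scaleComparable hψ hδ hlam hΨ
  have hcC : ENNReal.ofReal K⁻¹ * ENNReal.ofReal K = 1 := by
    rw [← ENNReal.ofReal_mul (by positivity), inv_mul_cancel₀ hK.ne', ENNReal.ofReal_one]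
  have hmul_le {x y : ℝ≥0∞} (h : x ≤ ENNReal.ofReal K * y) : ENNReal.ofReal K⁻¹ * x ≤ y := by
    refine (mul_le_mul_right h _).trans_eq ?_
    rw [← mul_assoc, hcC, one_mul]
  have hle_mul {x y : ℝ≥0∞} (h : ENNReal.ofReal K⁻¹ * x ≤ y) : x ≤ ENNReal.ofReal K * y := by
    refine le_trans (le_of_eq ?_) (mul_le_mul_right h _)
    rw [← mul_assoc, mul_comm (ENNReal.ofReal K), hcC, one_mul]
  refine ⟨ENNReal.ofReal K⁻¹, ENNReal.ofReal K, ENNReal.ofReal_pos.2 (by positivity),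
    ENNReal.ofReal_ne_top, fun ω hω => ⟨fun _ => ⟨?_, ?_⟩, fun _ => ⟨?_, ?_⟩⟩⟩
  · refine hmul_le (ENNReal.le_of_forall_nnreal_lt fun β hβ => ?_)
    rcases eq_or_ne β 0 with rfl | hβ0
    · simp
    have hβ0 : 0 < (β : ℝ) := NNReal.coe_pos.2 (pos_iff_ne_zero.2 hβ0)
    rw [← ENNReal.ofReal_coe_nnreal] at hβ ⊢
    refine hle_mul (le_trans (le_of_eq ?_) (le_iSup₂_of_le (β / K) (by positivity)
      (le_iSup_of_le (hμ.mem_SsetH_of_lt_upperDensity hE hδ hlam hψ hK hcmp hω hβ0 hβ) le_rfl)))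
    rw [← ENNReal.ofReal_mul (by positivity), div_eq_inv_mul]
  · refine iSup_le fun α => iSup₂_le fun hα hS => hle_mul ?_
    rw [← ENNReal.ofReal_mul (by positivity), ← div_eq_inv_mul]
    exact hμ.le_upperDensity_of_mem_SsetH hE hδ hlam hψ hK hcmp hω hα hS
  · refine le_iInf fun α => le_iInf₂ fun hα hS => hmul_le ?_
    rw [← ENNReal.ofReal_mul hK.le]
    exact hμ.lowerDensity_le_of_mem_SsetP hE hδ hlam hK hcmp hω hα hS
  · refine hle_mul (le_of_forall_gt_imp_ge_of_dense fun b hb => ?_)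
    rcases eq_or_ne b ⊤ with rfl | hb'
    · exact le_top
    lift b to ℝ≥0 using hb'
    have hb0 : 0 < (b : ℝ) := NNReal.coe_pos.2 (ENNReal.coe_pos.1 (bot_le.trans_lt hb))
    rw [← ENNReal.ofReal_coe_nnreal] at hb ⊢
    refine hmul_le (iInf₂_le_of_le (K * b) (by positivity) (iInf_le_of_le
      (hμ.mem_SsetP_of_lowerDensity_lt hE hδ hlam hψ hcmp hω hb0 hb) ?_))
    rw [← ENNReal.ofReal_mul hK.le]
end
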